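/- Fix (z,w) ∈ Λ with representative sequence (z_i,w_i)_{i∈ℕ}, and suppose λ := lim_{n→∞} λ(n)/n and ξ := lim_{n→∞} ξ(n)/n exist with ξ > λ. (a) If w_i ≠ 0 for infinitely many i, p_0(z,w) := lim_{n→∞} #{1 ≤ i ≤ n : w_i = 0}/n = 1, and either #J₂(b−1) ≤ #J₂(0) or lim_{n→∞} k_n(w,0)/n = 0 where k_n(w,0) = inf{ j − n : j > n and w_j ≠ 0 }, then dim_H Λ_{λ,ξ}(z,w) = min{ γ/(1+λ), (γ + (ξ−λ)·log #J₂(0)/log b)/(1+ξ) }. (b) Analogously, if w_i ≠ b−1 for infinitely many i, p_{b−1}(z,w) = 1, and either #J₂(b−1) ≥ #J₂(0) or lim_{n→∞} k_n(w,b−1)/n = 0 where k_n(w,b−1) = inf{ j − n : j > n and w_j ≠ b−1 }, then dim_H Λ_{λ,ξ}(z,w) = min{ γ/(1+λ), (γ + (ξ−λ)·log #J₂(b−1)/log b)/(1+ξ) }. Here γ = log #J / log b. -/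

import Mathlib

open Set Filter Topology MeasureTheory
open scoped ENNReal NNReal Topology

noncomputable section

namespace ShrinkingRect

/-- The real number with 1-indexed base-`b` digit sequence `u` (digit `i` is `u i` for `i ≥ 1`). -/
def val (b : ℕ) (u : ℕ → ℕ) : ℝ := ∑' i : ℕ, (u (i + 1) : ℝ) / (b : ℝ) ^ (i + 1)

/-- The self-similar carpet `Λ` with digit set `J ⊆ {0,…,b−1}²`. -/
def carpet (b : ℕ) (J : Finset (ℕ × ℕ)) : Set (ℝ × ℝ) :=
  {p | ∃ d : ℕ → ℕ × ℕ, (∀ i, 1 ≤ i → d i ∈ J) ∧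
    p = (val b (fun i => (d i).1), val b (fun i => (d i).2))}

/-- `J₂(a)`: the digits of `J` lying in row `a`. -/
def J2 (J : Finset (ℕ × ℕ)) (a : ℕ) : Finset (ℕ × ℕ) := J.filter fun p => p.2 = a

/-- The contraction `f_{u,v}(x,y) = ((x+u)/b, (y+v)/b)`. -/
def fmap (b : ℕ) (uv : ℕ × ℕ) (p : ℝ × ℝ) : ℝ × ℝ :=
  ((p.1 + (uv.1 : ℝ)) / b, (p.2 + (uv.2 : ℝ)) / b)

/-- `f_t = f_{u₁,v₁} ∘ ⋯ ∘ f_{uₙ,vₙ}` for a finite word `t = ((u₁,v₁),…,(uₙ,vₙ))`. -/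
def fword (b : ℕ) (t : List (ℕ × ℕ)) (p : ℝ × ℝ) : ℝ × ℝ :=
  t.foldr (fmap b) p

/-- The limsup set `W_{λ,ξ}(z,w)`. -/
def Wset (b : ℕ) (J : Finset (ℕ × ℕ)) (lam xi : ℕ → ℕ) (z w : ℝ) : Set (ℝ × ℝ) :=
  {p | p ∈ carpet b J ∧
    {t : List (ℕ × ℕ) | t ≠ [] ∧ (∀ e ∈ t, e ∈ J) ∧
      |p.1 - (fword b t (z, w)).1| ≤ (b : ℝ) ^ (-(lam t.length : ℤ) - (t.length : ℤ)) ∧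
      |p.2 - (fword b t (z, w)).2| ≤ (b : ℝ) ^ (-(xi t.length : ℤ) - (t.length : ℤ))}.Infinite}

/-- The closeness condition (in one coordinate) defining `M_n(z,w)`:
`xd` is the digit string of the point, `zd` that of the centre, `L` is `λ(n)` or `ξ(n)`. -/
def closeCond (b L n : ℕ) (zd xd : ℕ → ℕ) : Prop :=
  (∀ i, 1 ≤ i → i < L → xd (i + n) = zd i) ∨
  (∃ j, 1 ≤ j ∧ j < L ∧ (∀ i, 1 ≤ i → i ≤ j - 1 → xd (i + n) = zd i) ∧
    (((xd (j + n) : ℤ) - (zd j : ℤ) = -1 ∧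
        ∀ i, j + 1 ≤ i → i < L → (xd (i + n) : ℤ) - (zd i : ℤ) = (b : ℤ) - 1) ∨
     ((xd (j + n) : ℤ) - (zd j : ℤ) = 1 ∧
        ∀ i, j + 1 ≤ i → i < L → (zd i : ℤ) - (xd (i + n) : ℤ) = (b : ℤ) - 1)))

/-- A choice of representative digit sequences for the points of the carpet: each point of `Λ`
gets a digit sequence in `J` representing it, whose partial products of row cardinalities
`∏ #J₂(y_i)` are eventually maximal among all representations of that point. -/
structure RepMap (b : ℕ) (J : Finset (ℕ × ℕ)) where
  rep : ℝ × ℝ → ℕ → ℕ × ℕ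
  mem_J : ∀ p ∈ carpet b J, ∀ i, 1 ≤ i → rep p i ∈ J
  eq_val : ∀ p ∈ carpet b J,
    p = (val b (fun i => (rep p i).1), val b (fun i => (rep p i).2))
  maximal : ∀ p ∈ carpet b J, ∀ d : ℕ → ℕ × ℕ, (∀ i, 1 ≤ i → d i ∈ J) →
    p = (val b (fun i => (d i).1), val b (fun i => (d i).2)) →
    ∃ N₀ : ℕ, ∀ N, N₀ ≤ N →
      ∏ i ∈ Finset.Icc 1 N, (J2 J (d i).2).card ≤
        ∏ i ∈ Finset.Icc 1 N, (J2 J (rep p i).2).card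

/-- The expanding map `T(x,y) = (bx − x₁, by − y₁)`, where `(x_i,y_i)` is the representative
digit sequence of `(x,y)`. -/
def Tmap {b : ℕ} {J : Finset (ℕ × ℕ)} (R : RepMap b J) (p : ℝ × ℝ) : ℝ × ℝ :=
  ((b : ℝ) * p.1 - ((R.rep p 1).1 : ℝ), (b : ℝ) * p.2 - ((R.rep p 1).2 : ℝ))

/-- The shrinking target set `Λ_{λ,ξ}(z,w)`. -/
def targetSet {b : ℕ} {J : Finset (ℕ × ℕ)} (R : RepMap b J) (lam xi : ℕ → ℕ)
    (z w : ℝ) : Set (ℝ × ℝ) :=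
  {p | p ∈ carpet b J ∧ ∃ᶠ n in atTop,
    ((Tmap R)^[n] p).1 ∈ Icc (z - (b : ℝ) ^ (-(lam n : ℤ))) (z + (b : ℝ) ^ (-(lam n : ℤ))) ∧
    ((Tmap R)^[n] p).2 ∈ Icc (w - (b : ℝ) ^ (-(xi n : ℤ))) (w + (b : ℝ) ^ (-(xi n : ℤ)))}

/-- The set `M_n(z,w)` (as a set of points of `Λ`, via representative sequences). -/
def Mset {b : ℕ} {J : Finset (ℕ × ℕ)} (R : RepMap b J) (lam xi : ℕ → ℕ)
    (zw : ℝ × ℝ) (n : ℕ) : Set (ℝ × ℝ) :=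
  {p | p ∈ carpet b J ∧
    closeCond b (lam n) n (fun i => (R.rep zw i).1) (fun i => (R.rep p i).1) ∧
    closeCond b (xi n) n (fun i => (R.rep zw i).2) (fun i => (R.rep p i).2)}

/-- `p_{n,j}(a,y) = #{λ(n) ≤ i ≤ j : y_{i+n} = a}`. -/
def pcount {b : ℕ} {J : Finset (ℕ × ℕ)} (R : RepMap b J) (lam : ℕ → ℕ)
    (p : ℝ × ℝ) (a n j : ℕ) : ℕ :=
  ((Finset.Icc (lam n) j).filter fun i => (R.rep p (i + n)).2 = a).card

/-- `A_{n,j}(z,w) = max_{(x,y) ∈ M_n(z,w)} Σ_a p_{n,j}(a,y) log #J₂(a)`. -/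
def Aval {b : ℕ} {J : Finset (ℕ × ℕ)} (R : RepMap b J) (lam xi : ℕ → ℕ)
    (zw : ℝ × ℝ) (n j : ℕ) : ℝ :=
  sSup ((fun p => ∑ a ∈ Finset.range b,
    (pcount R lam p a n j : ℝ) * Real.log ((J2 J a).card)) '' Mset R lam xi zw n)

/-- `s_n = min{ (n log #J + A_{n,j}(z,w)) / ((n+j) log b) : λ(n) ≤ j ≤ ξ(n) }`. -/
def sval {b : ℕ} {J : Finset (ℕ × ℕ)} (R : RepMap b J) (lam xi : ℕ → ℕ)
    (zw : ℝ × ℝ) (n : ℕ) : ℝ :=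
  sInf ((fun j : ℕ => ((n : ℝ) * Real.log J.card + Aval R lam xi zw n j) /
    (((n : ℝ) + (j : ℝ)) * Real.log b)) '' Set.Icc (lam n) (xi n))

/-- `#{1 ≤ i ≤ n : u i = a}`. -/
def freqCount (u : ℕ → ℕ) (a n : ℕ) : ℕ := ((Finset.Icc 1 n).filter fun i => u i = a).card

/-- The second-coordinate digit string of the representative sequence of a point. -/
def wdig {b : ℕ} {J : Finset (ℕ × ℕ)} (R : RepMap b J) (zw : ℝ × ℝ) (i : ℕ) : ℕ :=
  (R.rep zw i).2

/-- The real number whose base-`b` digits, starting from index `0`, are `u`. -/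
def expansion (b : ℕ) (u : ℕ → ℕ) : ℝ := ∑' i : ℕ, (u i : ℝ) / (b : ℝ) ^ (i + 1)

/-- The natural number whose base-`b` digits are `u 0, …, u (M - 1)`, most significant first. -/
def prefixInt (b : ℕ) (u : ℕ → ℕ) : ℕ → ℕ
  | 0 => 0
  | M + 1 => b * prefixInt b u M + u M

/-- The point of the plane whose coordinates have the digits `d`, starting from index `0`. -/
def point (b : ℕ) (d : ℕ → ℕ × ℕ) : ℝ × ℝ :=
  (expansion b fun i => (d i).1, expansion b fun i => (d i).2)

section Digits

variable {b : ℕ} {u v : ℕ → ℕ}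

theorem hasSum_maxDigits (hb : 2 ≤ b) :
    HasSum (fun i : ℕ => ((b : ℝ) - 1) / (b : ℝ) ^ (i + 1)) 1 := by
  have hb' : (2 : ℝ) ≤ b := by exact_mod_cast hb
  have h := (hasSum_geometric_of_lt_one (r := (b : ℝ)⁻¹) (by positivity)
    (inv_lt_one_of_one_lt₀ (by linarith))).mul_left (((b : ℝ) - 1) / b)
  have hb1 : (b : ℝ) - 1 ≠ 0 := by linarith
  have hsum : ((b : ℝ) - 1) / b * (1 - (b : ℝ)⁻¹)⁻¹ = 1 := by field_simp
  rw [hsum] at h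
  have hfun : (fun i : ℕ => ((b : ℝ) - 1) / (b : ℝ) ^ (i + 1)) =
      fun i => ((b : ℝ) - 1) / b * (b : ℝ)⁻¹ ^ i := by
    ext i
    rw [inv_pow, pow_succ]
    field_simp
  rwa [hfun]

theorem digit_div_le (hb : 2 ≤ b) (hu : ∀ i, u i < b) (i : ℕ) :
    (u i : ℝ) / (b : ℝ) ^ (i + 1) ≤ ((b : ℝ) - 1) / (b : ℝ) ^ (i + 1) := by
  have : (u i : ℝ) + 1 ≤ b := by exact_mod_cast hu i
  gcongr
  linarith

theorem summable_digits (hb : 2 ≤ b) (hu : ∀ i, u i < b) :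
    Summable fun i : ℕ => (u i : ℝ) / (b : ℝ) ^ (i + 1) :=
  Summable.of_nonneg_of_le (fun _ => by positivity) (digit_div_le hb hu)
    (hasSum_maxDigits hb).summable

theorem expansion_nonneg : 0 ≤ expansion b u := tsum_nonneg fun _ => by positivity

theorem expansion_le_one (hb : 2 ≤ b) (hu : ∀ i, u i < b) : expansion b u ≤ 1 := by
  rw [← (hasSum_maxDigits hb).tsum_eq]
  exact (summable_digits hb hu).tsum_le_tsum (digit_div_le hb hu) (hasSum_maxDigits hb).summable

theorem expansion_eq_head_add (hb : 2 ≤ b) (hu : ∀ i, u i < b) :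
    (b : ℝ) * expansion b u = u 0 + expansion b fun i => u (i + 1) := by
  have hb' : (b : ℝ) ≠ 0 := by positivity
  rw [expansion, (summable_digits hb hu).tsum_eq_zero_add, mul_add, ← tsum_mul_left, expansion]
  congr 1
  · rw [zero_add, pow_one, mul_div_cancel₀ _ hb']
  · congr 1
    ext i
    rw [pow_succ]
    field_simp

theorem pow_mul_expansion (hb : 2 ≤ b) (hu : ∀ i, u i < b) (M : ℕ) :
    (b : ℝ) ^ M * expansion b u = prefixInt b u M + expansion b fun i => u (i + M) := by
  induction M with
  | zero => simp [prefixInt]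
  | succ M ih =>
    have h := expansion_eq_head_add hb (u := fun i => u (i + M)) fun i => hu _
    rw [pow_succ, mul_comm _ (b : ℝ), mul_assoc, ih, mul_add, h, prefixInt]
    have : (fun i => u (i + 1 + M)) = fun i => u (i + (M + 1)) := by
      ext i
      congr 1
      ring
    simp only [zero_add, this]
    push_cast
    ring

theorem prefixInt_congr (M : ℕ) (h : ∀ i < M, u i = v i) : prefixInt b u M = prefixInt b v M := by
  induction M with
  | zero => rfl
  | succ M ih => rw [prefixInt, prefixInt, ih fun i hi => h i (by omega), h M (by omega)]

theorem digit_eq_of_prefixInt_eq (hu : ∀ i, u i < b) (hv : ∀ i, v i < b) (M : ℕ)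
    (h : prefixInt b u M = prefixInt b v M) : ∀ i < M, u i = v i := by
  induction M with
  | zero => intro i hi; omega
  | succ M ih =>
    rw [prefixInt, prefixInt] at h
    have hb : 0 < b := (Nat.zero_le _).trans_lt (hu 0)
    have h1 : u M = v M := by
      have := congrArg (· % b) h
      simpa [Nat.mul_add_mod, Nat.mod_eq_of_lt (hu M), Nat.mod_eq_of_lt (hv M)] using this
    have h2 : prefixInt b u M = prefixInt b v M := by
      rw [h1] at h
      exact Nat.eq_of_mul_eq_mul_left hb (by omega)
    intro i hi
    rcases Nat.lt_succ_iff_lt_or_eq.1 hi with hi | rfl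
    · exact ih h2 i hi
    · exact h1

theorem digits_of_prefixInt_succ (hu : ∀ i, u i < b) (hv : ∀ i, v i < b) (M : ℕ)
    (h : prefixInt b u M = prefixInt b v M + 1) :
    ∃ j < M, (∀ i < j, u i = v i) ∧ u j = v j + 1 ∧
      ∀ i, j < i → i < M → u i = 0 ∧ v i = b - 1 := by
  induction M with
  | zero => simp [prefixInt] at h
  | succ M ih =>
    rw [prefixInt, prefixInt] at h
    have h1 := hu M
    have h2 := hv M
    rcases lt_trichotomy (prefixInt b u M) (prefixInt b v M) with hlt | heq | hgt
    · nlinarith [Nat.mul_le_mul_left b (Nat.succ_le_of_lt hlt)]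
    · refine ⟨M, by omega, digit_eq_of_prefixInt_eq hu hv M heq, ?_, fun i h1 h2 => by omega⟩
      rw [heq] at h
      omega
    · obtain ⟨c, hc⟩ := Nat.exists_eq_add_of_lt hgt
      have hc0 : c = 0 := by
        rcases Nat.eq_zero_or_pos c with h0 | h0
        · exact h0
        · rw [hc] at h
          nlinarith
      subst hc0
      rw [hc] at h
      have h3 : b + u M = v M + 1 := by nlinarith
      obtain ⟨j, hj, hj1, hj2, hj3⟩ := ih (by omega)
      refine ⟨j, by omega, hj1, hj2, fun i hi hi' => ?_⟩
      rcases Nat.lt_succ_iff_lt_or_eq.1 hi' with hi' | rfl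
      · exact hj3 i hi hi'
      · omega

/-- Two digit strings whose prefixes encode integers at distance at most one are either equal or
agree up to some index, after which they run through opposite extreme digits. -/
theorem digits_of_prefixInt_close (hu : ∀ i, u i < b) (hv : ∀ i, v i < b) (M : ℕ)
    (h : |(prefixInt b u M : ℤ) - prefixInt b v M| ≤ 1) :
    (∀ i < M, u i = v i) ∨ ∃ j < M, (∀ i < j, u i = v i) ∧ u j ≠ v j ∧
      ((∀ i, j < i → i < M → u i = 0 ∧ v i = b - 1) ∨
        ∀ i, j < i → i < M → u i = b - 1 ∧ v i = 0) := by
  rw [abs_le] at h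
  have : prefixInt b u M = prefixInt b v M ∨ prefixInt b u M = prefixInt b v M + 1 ∨
    prefixInt b v M = prefixInt b u M + 1 := by omega
  rcases this with h | h | h
  · exact Or.inl (digit_eq_of_prefixInt_eq hu hv M h)
  · obtain ⟨j, hj, h1, h2, h3⟩ := digits_of_prefixInt_succ hu hv M h
    exact Or.inr ⟨j, hj, h1, by omega, Or.inl h3⟩
  · obtain ⟨j, hj, h1, h2, h3⟩ := digits_of_prefixInt_succ hv hu M h
    exact Or.inr ⟨j, hj, fun i hi => (h1 i hi).symm, by omega,
      Or.inr fun i hi hi' => (h3 i hi hi').symm⟩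

theorem prefixInt_close (hb : 2 ≤ b) (hu : ∀ i, u i < b) (hv : ∀ i, v i < b) (M : ℕ)
    (h : (b : ℝ) ^ M * |expansion b u - expansion b v| < 1) :
    |(prefixInt b u M : ℤ) - prefixInt b v M| ≤ 1 := by
  rw [← abs_of_pos (a := (b : ℝ) ^ M) (by positivity), ← abs_mul, mul_sub,
    pow_mul_expansion hb hu, pow_mul_expansion hb hv, abs_lt] at h
  have h1 := expansion_le_one hb (u := fun i => u (i + M)) fun i => hu _
  have h2 := expansion_le_one hb (u := fun i => v (i + M)) fun i => hv _
  have h3 := expansion_nonneg (b := b) (u := fun i => u (i + M))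
  have h4 := expansion_nonneg (b := b) (u := fun i => v (i + M))
  have h5 : ((prefixInt b u M : ℤ) : ℝ) - (prefixInt b v M : ℤ) < 2 := by push_cast; linarith
  have h6 : (-2 : ℝ) < ((prefixInt b u M : ℤ) : ℝ) - (prefixInt b v M : ℤ) := by
    push_cast; linarith
  have h7 : (prefixInt b u M : ℤ) - prefixInt b v M < 2 := by exact_mod_cast h5
  have h8 : -2 < (prefixInt b u M : ℤ) - prefixInt b v M := by exact_mod_cast h6
  rw [abs_le]
  omega

theorem eventually_const_of_expansion_eq (hb : 2 ≤ b) (hu : ∀ i, u i < b) (hv : ∀ i, v i < b)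
    (h : expansion b u = expansion b v) (hne : u ≠ v) : ∃ j, ∀ i, j < i → u i = u (j + 1) := by
  have hex : ∃ j, u j ≠ v j := Function.ne_iff.1 hne
  classical
  refine ⟨Nat.find hex, fun i hi => ?_⟩
  have hclose := prefixInt_close hb hu hv (i + 1) (by simp [h])
  rcases digits_of_prefixInt_close hu hv (i + 1) hclose with h1 | ⟨j, hj, h1, h2, h3⟩
  · exact absurd (h1 _ (by omega)) (Nat.find_spec hex)
  · have hjeq : Nat.find hex = j := by
      refine le_antisymm (Nat.find_le h2) ?_
      by_contra! hlt
      exact Nat.find_spec hex (h1 _ hlt)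
    rw [hjeq] at hi ⊢
    rcases h3 with h3 | h3
    · rw [(h3 i hi (by omega)).1, (h3 (j + 1) (by omega) (by omega)).1]
    · rw [(h3 i hi (by omega)).1, (h3 (j + 1) (by omega) (by omega)).1]

theorem abs_expansion_sub_le (hb : 2 ≤ b) (hu : ∀ i, u i < b) (hv : ∀ i, v i < b) (M : ℕ)
    (h : ∀ i < M, u i = v i) : |expansion b u - expansion b v| ≤ ((b : ℝ) ^ M)⁻¹ := by
  have h1 := pow_mul_expansion hb hu M
  have h2 := pow_mul_expansion hb hv M
  rw [prefixInt_congr M h] at h1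
  have h3 := expansion_le_one hb (u := fun i => u (i + M)) fun i => hu _
  have h4 := expansion_le_one hb (u := fun i => v (i + M)) fun i => hv _
  have h5 := expansion_nonneg (b := b) (u := fun i => u (i + M))
  have h6 := expansion_nonneg (b := b) (u := fun i => v (i + M))
  have hpos : (0 : ℝ) < (b : ℝ) ^ M := by positivity
  rw [← one_div, abs_le, ← neg_div, div_le_iff₀ hpos, le_div_iff₀ hpos]
  constructor <;> linarith

end Digits

section Orbits

variable {b : ℕ} {J : Finset (ℕ × ℕ)}

theorem point_mem_carpet {d : ℕ → ℕ × ℕ} (hd : ∀ i, d i ∈ J) : point b d ∈ carpet b J :=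
  ⟨fun i => d (i - 1), fun _ _ => hd _, rfl⟩

theorem rep_succ_mem (R : RepMap b J) {p : ℝ × ℝ} (hp : p ∈ carpet b J) (i : ℕ) :
    R.rep p (i + 1) ∈ J := R.mem_J p hp _ (by omega)

theorem point_rep (R : RepMap b J) {p : ℝ × ℝ} (hp : p ∈ carpet b J) :
    point b (fun i => R.rep p (i + 1)) = p := (R.eq_val p hp).symm

theorem Tmap_eq_point (hb : 2 ≤ b) (hJ : ∀ e ∈ J, e.1 < b ∧ e.2 < b) (R : RepMap b J)
    {p : ℝ × ℝ} (hp : p ∈ carpet b J) :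
    Tmap R p = point b fun i => R.rep p (i + 2) := by
  have h := point_rep R hp
  have h1 := expansion_eq_head_add hb (u := fun i => (R.rep p (i + 1)).1)
    fun i => (hJ _ (rep_succ_mem R hp i)).1
  have h2 := expansion_eq_head_add hb (u := fun i => (R.rep p (i + 1)).2)
    fun i => (hJ _ (rep_succ_mem R hp i)).2
  rw [show (expansion b fun i => (R.rep p (i + 1)).1) = p.1 from congrArg Prod.fst h] at h1
  rw [show (expansion b fun i => (R.rep p (i + 1)).2) = p.2 from congrArg Prod.snd h] at h2
  ext
  · simp only [Tmap, h1, point]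
    ring_nf
  · simp only [Tmap, h2, point]
    ring_nf

theorem exists_digits_iterate (hb : 2 ≤ b) (hJ : ∀ e ∈ J, e.1 < b ∧ e.2 < b) (R : RepMap b J)
    (n : ℕ) : ∀ p ∈ carpet b J, ∃ d : ℕ → ℕ × ℕ, (∀ i, d i ∈ J) ∧ p = point b d ∧
      (Tmap R)^[n] p = point b fun i => d (i + n) := by
  induction n with
  | zero =>
    intro p hp
    exact ⟨_, rep_succ_mem R hp, (point_rep R hp).symm, (point_rep R hp).symm⟩
  | succ n ih =>
    intro p hp
    have hT := Tmap_eq_point hb hJ R hp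
    have hTmem : Tmap R p ∈ carpet b J := by
      rw [hT]
      exact point_mem_carpet fun i => rep_succ_mem R hp (i + 1)
    obtain ⟨d, hd, h1, h2⟩ := ih _ hTmem
    let d' : ℕ → ℕ × ℕ := fun i => Nat.casesOn i (R.rep p 1) d
    have hd' : ∀ i, d' i ∈ J := by
      rintro (_ | i)
      · exact rep_succ_mem R hp 0
      · exact hd i
    refine ⟨d', hd', ?_, by rw [Function.iterate_succ_apply, h2]; rfl⟩
    have h3 := expansion_eq_head_add hb (u := fun i => (d' i).1) fun i => (hJ _ (hd' i)).1
    have h4 := expansion_eq_head_add hb (u := fun i => (d' i).2) fun i => (hJ _ (hd' i)).2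
    have hb0 : (b : ℝ) ≠ 0 := by positivity
    have h5 : (b : ℝ) * p.1 - ((R.rep p 1).1 : ℝ) = expansion b fun i => (d i).1 :=
      congrArg Prod.fst h1
    have h6 : (b : ℝ) * p.2 - ((R.rep p 1).2 : ℝ) = expansion b fun i => (d i).2 :=
      congrArg Prod.snd h1
    ext
    · refine mul_left_cancel₀ hb0 (Eq.trans ?_ h3.symm)
      change (b : ℝ) * p.1 = (R.rep p 1).1 + expansion b fun i => (d i).1
      linarith
    · refine mul_left_cancel₀ hb0 (Eq.trans ?_ h4.symm)
      change (b : ℝ) * p.2 = (R.rep p 1).2 + expansion b fun i => (d i).2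
      linarith

/-- A coordinate of a digit sequence using every digit of `J` infinitely often is determined by
its expansion. -/
theorem coord_digits_unique (hb : 2 ≤ b) {c : ℕ × ℕ → ℕ} (hc : ∀ e ∈ J, c e < b)
    {d d' : ℕ → ℕ × ℕ} (hd : ∀ i, d i ∈ J) (hd' : ∀ i, d' i ∈ J)
    (hinf : ∀ e ∈ J, ∃ᶠ i in atTop, d i = e)
    (h : expansion b (fun i => c (d i)) = expansion b fun i => c (d' i)) (i : ℕ) :
    c (d i) = c (d' i) := by
  by_contra hne
  obtain ⟨j, hj⟩ := eventually_const_of_expansion_eq hb (fun i => hc _ (hd i))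
    (fun i => hc _ (hd' i)) h fun heq => hne (congrFun heq i)
  have hconst : ∀ e ∈ J, c e = c (d (j + 1)) := by
    intro e he
    obtain ⟨k, hk, hke⟩ := ((hinf e he).and_eventually (eventually_gt_atTop j)).exists
    rw [← hk]
    exact hj k hke
  exact hne ((hconst _ (hd i)).trans (hconst _ (hd' i)).symm)

theorem digits_unique (hb : 2 ≤ b) (hJ : ∀ e ∈ J, e.1 < b ∧ e.2 < b) {d d' : ℕ → ℕ × ℕ}
    (hd : ∀ i, d i ∈ J) (hd' : ∀ i, d' i ∈ J) (hinf : ∀ e ∈ J, ∃ᶠ i in atTop, d i = e)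
    (h : point b d = point b d') : d = d' := by
  ext i
  · exact coord_digits_unique hb (fun e he => (hJ e he).1) hd hd' hinf (congrArg Prod.fst h) i
  · exact coord_digits_unique hb (fun e he => (hJ e he).2) hd hd' hinf (congrArg Prod.snd h) i

theorem iterate_Tmap_point (hb : 2 ≤ b) (hJ : ∀ e ∈ J, e.1 < b ∧ e.2 < b) (R : RepMap b J)
    {d : ℕ → ℕ × ℕ} (hd : ∀ i, d i ∈ J) (hinf : ∀ e ∈ J, ∃ᶠ i in atTop, d i = e) (n : ℕ) :
    (Tmap R)^[n] (point b d) = point b fun i => d (i + n) := by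
  obtain ⟨d', hd', h1, h2⟩ := exists_digits_iterate hb hJ R n _ (point_mem_carpet hd)
  rw [h2, digits_unique hb hJ hd hd' hinf h1]

end Orbits

section LowerBound

variable {b : ℕ}

/-- The map sending a digit sequence, truncated to admissible digits, to the point it encodes. -/
def clampedPoint (b : ℕ) (d : ℕ → ℕ × ℕ) : ℝ × ℝ :=
  point b fun i => (min (d i).1 (b - 1), min (d i).2 (b - 1))

theorem clampedPoint_eq {d : ℕ → ℕ × ℕ} (hd : ∀ i, (d i).1 < b ∧ (d i).2 < b) :
    clampedPoint b d = point b d := by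
  have : (fun i => (min (d i).1 (b - 1), min (d i).2 (b - 1))) = d := by
    ext i
    · exact min_eq_left (by have := (hd i).1; omega)
    · exact min_eq_left (by have := (hd i).2; omega)
  rw [clampedPoint, this]

theorem measurable_expansion_clamped (hb : 2 ≤ b) {c : ℕ × ℕ → ℕ} :
    Measurable fun d : ℕ → ℕ × ℕ => expansion b fun i => min (c (d i)) (b - 1) := by
  refine measurable_of_tendsto_metrizable (f := fun n (d : ℕ → ℕ × ℕ) =>
    ∑ i ∈ Finset.range n, ((min (c (d i)) (b - 1) : ℕ) : ℝ) / (b : ℝ) ^ (i + 1))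
    (fun n => Finset.measurable_fun_sum _ fun i _ => ?_) (tendsto_pi_nhds.2 fun d => ?_)
  · exact (measurable_from_prod_countable_left fun _ => measurable_from_nat :
      Measurable fun e : ℕ × ℕ => ((min (c e) (b - 1) : ℕ) : ℝ) / (b : ℝ) ^ (i + 1)).comp
      (measurable_pi_apply i)
  · exact (summable_digits hb (u := fun i => min (c (d i)) (b - 1))
      fun i => by omega).hasSum.tendsto_sum_nat

theorem measurable_clampedPoint (hb : 2 ≤ b) : Measurable (clampedPoint b) :=
  (measurable_expansion_clamped hb (c := Prod.fst)).prodMk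
    (measurable_expansion_clamped hb (c := Prod.snd))

/-- The product of the uniform measures on the finite sets `D i`. -/
def uniformProduct (D : ℕ → Finset (ℕ × ℕ)) : Measure (ℕ → ℕ × ℕ) :=
  Measure.infinitePi fun i => ProbabilityTheory.uniformOn (D i : Set (ℕ × ℕ))

variable {D : ℕ → Finset (ℕ × ℕ)}

theorem isProbabilityMeasure_uniformOn_finset (hne : ∀ i, (D i).Nonempty) (i : ℕ) :
    IsProbabilityMeasure (ProbabilityTheory.uniformOn (D i : Set (ℕ × ℕ))) :=
  ProbabilityTheory.isProbabilityMeasure_uniformOn (D i).finite_toSet (hne i)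

theorem uniformProduct_compl (hne : ∀ i, (D i).Nonempty) :
    uniformProduct D {d | ∀ i, d i ∈ D i}ᶜ = 0 := by
  have := isProbabilityMeasure_uniformOn_finset hne
  have hset : {d : ℕ → ℕ × ℕ | ∀ i, d i ∈ D i}ᶜ =
      ⋃ i, Set.pi ({i} : Finset ℕ) fun i => ((D i : Set (ℕ × ℕ)))ᶜ := by
    ext d
    simp
  rw [hset, measure_iUnion_null_iff]
  intro i
  rw [uniformProduct, Measure.infinitePi_pi _ fun i _ => (D i).measurableSet.compl,
    Finset.prod_singleton, ProbabilityTheory.uniformOn_eq_zero_iff (D i).finite_toSet,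
    Set.inter_compl_self]

theorem uniformProduct_cylinder (hne : ∀ i, (D i).Nonempty) (M : ℕ) {d₀ : ℕ → ℕ × ℕ}
    (hd₀ : ∀ i, d₀ i ∈ D i) :
    uniformProduct D {d | ∀ i < M, d i = d₀ i} = ∏ i ∈ Finset.range M, ((D i).card : ℝ≥0∞)⁻¹ := by
  have := isProbabilityMeasure_uniformOn_finset hne
  have hset : {d : ℕ → ℕ × ℕ | ∀ i < M, d i = d₀ i} =
      Set.pi (Finset.range M) fun i => {d₀ i} := by
    ext d
    simp [Set.mem_pi]
  rw [hset, uniformProduct, Measure.infinitePi_pi _ fun i _ => measurableSet_singleton _]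
  refine Finset.prod_congr rfl fun i _ => ?_
  rw [← Finset.coe_singleton, ProbabilityTheory.uniformOn_apply_finset,
    Finset.inter_singleton_of_mem (hd₀ i)]
  simp

theorem uniformProduct_prefix_le (hne : ∀ i, (D i).Nonempty)
    (hD : ∀ i, ∀ e ∈ D i, e.1 < b ∧ e.2 < b) (M : ℕ) (X Y : ℤ) :
    uniformProduct D {d | (∀ i, d i ∈ D i) ∧ (prefixInt b (fun i => (d i).1) M : ℤ) = X ∧
      (prefixInt b (fun i => (d i).2) M : ℤ) = Y} ≤
      ∏ i ∈ Finset.range M, ((D i).card : ℝ≥0∞)⁻¹ := by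
  rcases Set.eq_empty_or_nonempty {d : ℕ → ℕ × ℕ | (∀ i, d i ∈ D i) ∧
    (prefixInt b (fun i => (d i).1) M : ℤ) = X ∧
      (prefixInt b (fun i => (d i).2) M : ℤ) = Y} with h | ⟨d₀, h₀, hX, hY⟩
  · rw [h, measure_empty]
    exact zero_le
  · rw [← uniformProduct_cylinder hne M h₀]
    refine measure_mono fun d hd i hi => ?_
    ext
    · exact digit_eq_of_prefixInt_eq (fun i => (hD i _ (hd.1 i)).1) (fun i => (hD i _ (h₀ i)).1) M
        (by have := hd.2.1; omega) i hi
    · exact digit_eq_of_prefixInt_eq (fun i => (hD i _ (hd.1 i)).2) (fun i => (hD i _ (h₀ i)).2) M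
        (by have := hd.2.2; omega) i hi

theorem pow_mul_abs_sub_lt_one (hb : 2 ≤ b) {x y : ℝ} {M : ℕ}
    (h : |x - y| ≤ ((b : ℝ) ^ (M + 1))⁻¹) : (b : ℝ) ^ M * |x - y| < 1 := by
  have hb' : (2 : ℝ) ≤ b := by exact_mod_cast hb
  have hpos : (0 : ℝ) < (b : ℝ) ^ M := by positivity
  calc (b : ℝ) ^ M * |x - y| ≤ (b : ℝ) ^ M * ((b : ℝ) ^ (M + 1))⁻¹ := by gcongr
    _ = (b : ℝ)⁻¹ := by
      rw [pow_succ, mul_inv, ← mul_assoc, mul_inv_cancel₀ hpos.ne', one_mul]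
    _ < 1 := inv_lt_one_of_one_lt₀ (by linarith)

theorem uniformProduct_preimage_le (hb : 2 ≤ b) (hne : ∀ i, (D i).Nonempty)
    (hD : ∀ i, ∀ e ∈ D i, e.1 < b ∧ e.2 < b) (M : ℕ) {s : Set (ℝ × ℝ)}
    (hs : Metric.ediam s ≤ ENNReal.ofReal ((b : ℝ) ^ (M + 1))⁻¹) :
    uniformProduct D (clampedPoint b ⁻¹' s) ≤
      9 * ∏ i ∈ Finset.range M, ((D i).card : ℝ≥0∞)⁻¹ := by
  have hG : uniformProduct D (clampedPoint b ⁻¹' s) ≤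
      uniformProduct D (clampedPoint b ⁻¹' s ∩ {d | ∀ i, d i ∈ D i}) := by
    refine (measure_mono ?_).trans ((measure_union_le
      (clampedPoint b ⁻¹' s ∩ {d | ∀ i, d i ∈ D i}) {d | ∀ i, d i ∈ D i}ᶜ).trans ?_)
    · intro d hd
      by_cases h : d ∈ {d : ℕ → ℕ × ℕ | ∀ i, d i ∈ D i}
      · exact Or.inl ⟨hd, h⟩
      · exact Or.inr h
    · rw [uniformProduct_compl hne, add_zero]
  refine hG.trans ?_
  rcases Set.eq_empty_or_nonempty (clampedPoint b ⁻¹' s ∩ {d | ∀ i, d i ∈ D i}) with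
    h | ⟨d₀, hs₀, h₀⟩
  · rw [h, measure_empty]
    exact zero_le
  set X := (prefixInt b (fun i => (d₀ i).1) M : ℤ) with hX
  set Y := (prefixInt b (fun i => (d₀ i).2) M : ℤ) with hY
  have hsub : clampedPoint b ⁻¹' s ∩ {d | ∀ i, d i ∈ D i} ⊆
      ⋃ k ∈ Finset.Icc (X - 1) (X + 1) ×ˢ Finset.Icc (Y - 1) (Y + 1),
        {d | (∀ i, d i ∈ D i) ∧ (prefixInt b (fun i => (d i).1) M : ℤ) = k.1 ∧
          (prefixInt b (fun i => (d i).2) M : ℤ) = k.2} := by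
    rintro d ⟨hds, hdD⟩
    have hdist := (Metric.edist_le_ediam_of_mem (Set.mem_preimage.1 hds) (Set.mem_preimage.1 hs₀)).trans hs
    rw [clampedPoint_eq fun i => hD i _ (hdD i), clampedPoint_eq fun i => hD i _ (h₀ i),
      edist_dist, ENNReal.ofReal_le_ofReal_iff (by positivity), Prod.dist_eq, max_le_iff] at hdist
    have h1 := abs_le.1 (prefixInt_close hb (fun i => (hD i _ (hdD i)).1)
      (fun i => (hD i _ (h₀ i)).1) M (pow_mul_abs_sub_lt_one hb hdist.1))
    have h2 := abs_le.1 (prefixInt_close hb (fun i => (hD i _ (hdD i)).2)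
      (fun i => (hD i _ (h₀ i)).2) M (pow_mul_abs_sub_lt_one hb hdist.2))
    simp only [Set.mem_iUnion, Finset.mem_product, Finset.mem_Icc, Set.mem_ofPred_eq]
    exact ⟨((prefixInt b (fun i => (d i).1) M : ℤ), (prefixInt b (fun i => (d i).2) M : ℤ)),
      ⟨⟨by linarith, by linarith⟩, by linarith, by linarith⟩, hdD, rfl, rfl⟩
  refine (measure_mono hsub).trans ((measure_biUnion_finset_le _ _).trans ?_)
  refine (Finset.sum_le_card_nsmul _ _ _ fun k _ =>
    uniformProduct_prefix_le hne hD M k.1 k.2).trans (le_of_eq ?_)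
  rw [Finset.card_product, Int.card_Icc, Int.card_Icc, nsmul_eq_mul]
  have h3 : (X + 1 + 1 - (X - 1)).toNat = 3 := by omega
  have h4 : (Y + 1 + 1 - (Y - 1)).toNat = 3 := by omega
  rw [h3, h4]
  norm_num

/-- A set of points whose `i`-th digit pair ranges freely over `D i` has Hausdorff dimension at
least `t`, as soon as `∏_{i < M} #(D i)` dominates `b ^ (t M)`. -/
theorem le_dimH_image_point (hb : 2 ≤ b) (hne : ∀ i, (D i).Nonempty)
    (hD : ∀ i, ∀ e ∈ D i, e.1 < b ∧ e.2 < b) {t C : ℝ} (ht : 0 < t) (hC : 0 < C)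
    (h : ∀ M : ℕ, (b : ℝ) ^ (t * M) ≤ C * ∏ i ∈ Finset.range M, ((D i).card : ℝ)) :
    ENNReal.ofReal t ≤ dimH (point b '' {d | ∀ i, d i ∈ D i}) := by
  have hb' : (2 : ℝ) ≤ b := by exact_mod_cast hb
  have hb0 : (0 : ℝ) < b := by linarith
  have hprob := isProbabilityMeasure_uniformOn_finset hne
  set E := point b '' {d | ∀ i, d i ∈ D i} with hE
  set ν := (uniformProduct D).map (clampedPoint b) with hν
  have hcyl : ∀ (M : ℕ) (s : Set (ℝ × ℝ)),
      Metric.ediam s ≤ ENNReal.ofReal ((b : ℝ) ^ (M + 1))⁻¹ →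
      ν s ≤ ENNReal.ofReal (9 * C * (b : ℝ) ^ (-(t * M))) := by
    intro M s hs
    have hpos : ∀ i, (0 : ℝ) < (D i).card := fun i => by exact_mod_cast (hne i).card_pos
    have hprod : ∏ i ∈ Finset.range M, ((D i).card : ℝ≥0∞)⁻¹ =
        ENNReal.ofReal (∏ i ∈ Finset.range M, ((D i).card : ℝ))⁻¹ := by
      rw [← Finset.prod_inv_distrib, ENNReal.ofReal_prod_of_nonneg fun i _ => by positivity]
      refine Finset.prod_congr rfl fun i _ => ?_
      rw [ENNReal.ofReal_inv_of_pos (hpos i), ENNReal.ofReal_natCast]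
    have hP : (0 : ℝ) < ∏ i ∈ Finset.range M, ((D i).card : ℝ) :=
      Finset.prod_pos fun i _ => hpos i
    calc ν s ≤ ν (closure s) := measure_mono subset_closure
      _ = uniformProduct D (clampedPoint b ⁻¹' closure s) :=
        Measure.map_apply (measurable_clampedPoint hb) isClosed_closure.measurableSet
      _ ≤ 9 * ENNReal.ofReal (∏ i ∈ Finset.range M, ((D i).card : ℝ))⁻¹ := by
        rw [← hprod]
        exact uniformProduct_preimage_le hb hne hD M (by rwa [Metric.ediam_closure])
      _ ≤ _ := by
        rw [show (9 : ℝ≥0∞) = ENNReal.ofReal 9 by simp, ← ENNReal.ofReal_mul (by norm_num),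
          mul_assoc, Real.rpow_neg hb0.le]
        refine ENNReal.ofReal_le_ofReal (mul_le_mul_of_nonneg_left ?_ (by norm_num))
        rw [← div_eq_mul_inv, inv_eq_one_div, div_le_div_iff₀ hP (by positivity), one_mul]
        exact h M
  set c : ℝ := 9 * C * (b : ℝ) ^ (2 * t) with hc
  have hcpos : 0 < c := by positivity
  have hball : ∀ s : Set (ℝ × ℝ), Metric.ediam s ≤ ENNReal.ofReal (b : ℝ)⁻¹ →
      ((ENNReal.ofReal c)⁻¹ • ν) s ≤ Metric.ediam s ^ t := by
    intro s hs
    rw [Measure.smul_apply, smul_eq_mul, mul_comm, ← div_eq_mul_inv]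
    refine ENNReal.div_le_of_le_mul ?_
    have hfin : Metric.ediam s ≠ ∞ := ne_top_of_le_ne_top ENNReal.ofReal_ne_top hs
    obtain ⟨r, hr⟩ : ∃ r : ℝ, r = (Metric.ediam s).toReal := ⟨_, rfl⟩
    have hr0 : 0 ≤ r := hr ▸ ENNReal.toReal_nonneg
    have hdr : Metric.ediam s = ENNReal.ofReal r := by rw [hr, ENNReal.ofReal_toReal hfin]
    rw [hdr, ENNReal.ofReal_le_ofReal_iff (by positivity)] at hs
    rcases hr0.eq_or_lt with h0 | h0
    · have hlim : Tendsto (fun M : ℕ => ENNReal.ofReal (9 * C * (b : ℝ) ^ (-(t * M)))) atTop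
          (𝓝 0) := by
        rw [← ENNReal.ofReal_zero]
        refine ENNReal.tendsto_ofReal ?_
        have h1 : Tendsto (fun M : ℕ => ((b : ℝ) ^ (-t)) ^ M) atTop (𝓝 0) :=
          tendsto_pow_atTop_nhds_zero_of_lt_one (by positivity)
            (Real.rpow_lt_one_of_one_lt_of_neg (by linarith) (by linarith))
        have h2 := h1.const_mul (9 * C)
        rw [mul_zero] at h2
        refine h2.congr fun M => ?_
        rw [← Real.rpow_natCast, ← Real.rpow_mul hb0.le, neg_mul]
      have hz : ν s ≤ 0 := ge_of_tendsto' hlim fun M => hcyl M s (by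
        rw [hdr, ← h0, ENNReal.ofReal_zero]
        exact zero_le)
      exact hz.trans (zero_le)
    · obtain ⟨n, hn1, hn2⟩ := exists_nat_pow_near_of_lt_one h0
        (hs.trans (inv_le_one_of_one_le₀ (by linarith))) (inv_pos.2 hb0)
        (inv_lt_one_of_one_lt₀ (by linarith))
      obtain ⟨M, rfl⟩ : ∃ M, n = M + 1 := by
        refine Nat.exists_eq_succ_of_ne_zero ?_
        rintro rfl
        simp only [zero_add, pow_one] at hn1
        linarith
      refine (hcyl M s (by rw [hdr, ← inv_pow]; exact ENNReal.ofReal_le_ofReal hn2)).trans ?_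
      rw [hdr, ENNReal.ofReal_rpow_of_pos h0, ← ENNReal.ofReal_mul (by positivity)]
      refine ENNReal.ofReal_le_ofReal ?_
      have h1 : ((b : ℝ)⁻¹ ^ (M + 1 + 1)) ^ t ≤ r ^ t :=
        Real.rpow_le_rpow (by positivity) hn1.le ht.le
      have h2 : ((b : ℝ)⁻¹ ^ (M + 1 + 1)) ^ t = (b : ℝ) ^ (-(t * M)) * (b : ℝ) ^ (-(2 * t)) := by
        rw [← Real.rpow_neg_one, ← Real.rpow_natCast, ← Real.rpow_mul hb0.le,
          ← Real.rpow_mul hb0.le, ← Real.rpow_add hb0]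
        congr 1
        push_cast
        ring
      have h3 : (b : ℝ) ^ (-(2 * t)) * (b : ℝ) ^ (2 * t) = 1 := by
        rw [← Real.rpow_add hb0, neg_add_cancel, Real.rpow_zero]
      calc 9 * C * (b : ℝ) ^ (-(t * M))
          = (b : ℝ) ^ (-(t * M)) * (b : ℝ) ^ (-(2 * t)) * c := by
            rw [hc]
            linear_combination -(9 * C * (b : ℝ) ^ (-(t * M))) * h3
        _ ≤ r ^ t * c := by
            rw [← h2]
            gcongr
  have hle := Measure.le_hausdorffMeasure t _ _ (by positivity : 0 < ENNReal.ofReal (b : ℝ)⁻¹) hball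
  have hνE : 1 ≤ ν E := by
    refine le_trans ?_ (Measure.le_map_apply (measurable_clampedPoint hb).aemeasurable E)
    have hsub : {d : ℕ → ℕ × ℕ | ∀ i, d i ∈ D i} ⊆ clampedPoint b ⁻¹' E := by
      intro d hd
      rw [Set.mem_preimage, clampedPoint_eq fun i => hD i _ (hd i)]
      exact Set.mem_image_of_mem _ hd
    have hprob' : IsProbabilityMeasure (uniformProduct D) := by
      rw [uniformProduct]
      infer_instance
    refine le_trans (le_of_eq ?_) (measure_mono hsub)
    rw [eq_comm, ← prob_compl_eq_zero_iff, uniformProduct_compl hne]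
    have hset : {d : ℕ → ℕ × ℕ | ∀ i, d i ∈ D i} = Set.pi Set.univ fun i => (D i : Set _) := by
      ext d
      simp
    rw [hset]
    exact MeasurableSet.univ_pi fun i => (D i).measurableSet
  have hpos : μH[t] E ≠ 0 := by
    have h1 := hle E
    rw [Measure.smul_apply, smul_eq_mul] at h1
    intro h0
    rw [h0, nonpos_iff_eq_zero, mul_eq_zero, ENNReal.inv_eq_zero] at h1
    rcases h1 with h1 | h1
    · exact ENNReal.ofReal_ne_top h1
    · rw [h1] at hνE
      simp at hνE
  have := le_dimH_of_hausdorffMeasure_ne_zero (d := t.toNNReal) (s := E)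
    (by rwa [Real.coe_toNNReal t ht.le])
  exact this

end LowerBound

section LowerConstruction

variable {b : ℕ} {J : Finset (ℕ × ℕ)}

theorem exists_recurrent_enumeration (hJ : J.Nonempty) :
    ∃ e : ℕ → ℕ × ℕ, (∀ k, e k ∈ J) ∧ ∀ x ∈ J, ∃ᶠ k in atTop, e k = x := by
  have hpos : 0 < J.card := hJ.card_pos
  refine ⟨fun k => J.equivFin.symm ⟨k % J.card, Nat.mod_lt _ hpos⟩, fun k => Subtype.property _,
    fun x hx => frequently_atTop.2 fun a => ?_⟩
  refine ⟨J.card * a + J.equivFin ⟨x, hx⟩, by nlinarith, ?_⟩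
  have : (⟨(J.card * a + J.equivFin ⟨x, hx⟩) % J.card, Nat.mod_lt _ hpos⟩ : Fin J.card) =
      J.equivFin ⟨x, hx⟩ := by
    ext
    simp [Nat.mod_eq_of_lt]
  simp only [this, Equiv.symm_apply_apply]

/-- Digit sets prescribing the digit `e k` right before the time `N k`, the digits of `g` for
`λ (N k)` steps from then on, and the rows of `g` until `ξ (N k)` steps have passed. -/
theorem exists_digitSets (J : Finset (ℕ × ℕ)) (e g : ℕ → ℕ × ℕ) (lam xi N : ℕ → ℕ)
    (hN : ∀ k, N k + xi (N k) + 1 < N (k + 1)) (hle : ∀ n, lam n ≤ xi n) (hN0 : 1 ≤ N 0) :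
    ∃ D : ℕ → Finset (ℕ × ℕ), (∀ k, D (N k - 1) = {e k}) ∧
      (∀ k, ∀ r < lam (N k), D (N k + r) = {g r}) ∧
      (∀ k, ∀ r < xi (N k), lam (N k) ≤ r → D (N k + r) = J2 J (g r).2) ∧
      ∀ i, (∀ k, i + 1 ≠ N k) → (∀ k, N k ≤ i → N k + xi (N k) ≤ i) → D i = J := by
  classical
  have hmono : StrictMono N := strictMono_nat_of_lt_succ fun k => by have := hN k; omega
  have hpos : ∀ k, 1 ≤ N k := fun k => hN0.trans (hmono.monotone (Nat.zero_le k))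
  have hgap : ∀ {k l}, k < l → N k + xi (N k) + 1 < N l := fun {k l} hkl =>
    (hN k).trans_le (hmono.monotone hkl)
  have hwin : ∀ {k l i}, N k ≤ i → i < N k + xi (N k) → N l ≤ i → i < N l + xi (N l) →
      k = l := by
    intro k l i h1 h2 h3 h4
    rcases lt_trichotomy k l with h | h | h
    · have := hgap h
      omega
    · exact h
    · have := hgap h
      omega
  have hsep : ∀ {k l i}, N k ≤ i → i < N k + xi (N k) → i + 1 ≠ N l := by
    intro k l i h1 h2 h3
    rcases lt_or_ge k l with h | h
    · have := hgap h
      omega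
    · have := hmono.monotone h
      omega
  let D : ℕ → Finset (ℕ × ℕ) := fun i =>
    if h : ∃ k, i + 1 = N k then {e h.choose}
    else if h : ∃ k, N k ≤ i ∧ i < N k + xi (N k) then
      if i - N h.choose < lam (N h.choose) then {g (i - N h.choose)}
      else J2 J (g (i - N h.choose)).2
    else J
  have hDwin : ∀ k, ∀ r < xi (N k), D (N k + r) =
      if r < lam (N k) then {g r} else J2 J (g r).2 := by
    intro k r hr
    have h1 : ¬ ∃ l, N k + r + 1 = N l := fun ⟨l, hl⟩ =>
      hsep (k := k) (by omega) (by omega) hl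
    have h2 : ∃ l, N l ≤ N k + r ∧ N k + r < N l + xi (N l) := ⟨k, by omega, by omega⟩
    have h3 : h2.choose = k :=
      hwin h2.choose_spec.1 h2.choose_spec.2 (by omega) (by omega)
    simp only [D, dif_neg h1, dif_pos h2]
    rw [h3, Nat.add_sub_cancel_left]
  refine ⟨D, fun k => ?_, fun k r hr => ?_, fun k r hr hr' => ?_, fun i h1 h2 => ?_⟩
  · have h1 : ∃ l, N k - 1 + 1 = N l := ⟨k, by have := hpos k; omega⟩
    have h2 : h1.choose = k := by
      have := h1.choose_spec
      have h3 := hpos k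
      exact hmono.injective (by omega)
    simp only [D, dif_pos h1, h2]
  · rw [hDwin k r (hr.trans_le (hle _)), if_pos hr]
  · rw [hDwin k r hr, if_neg (by omega)]
  · have h3 : ¬ ∃ k, i + 1 = N k := fun ⟨k, hk⟩ => h1 k hk
    have h4 : ¬ ∃ k, N k ≤ i ∧ i < N k + xi (N k) := fun ⟨k, hk, hk'⟩ => by
      have := h2 k hk
      omega
    simp only [D, dif_neg h3, dif_neg h4]

theorem exists_sparse_sequence {P : ℕ → Prop} (hP : ∀ᶠ n in atTop, P n) (xi : ℕ → ℕ) {ε : ℝ}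
    (hε : 0 < ε) : ∃ N : ℕ → ℕ, (∀ k, P (N k)) ∧ 2 ≤ N 0 ∧ 1 ≤ ε * N 0 ∧
      (∀ k, N k + xi (N k) + 1 < N (k + 1)) ∧ ∀ k, (N k + xi (N k) : ℝ) + 1 ≤ ε * N (k + 1) := by
  have hlarge : ∀ A : ℕ, ∃ n, P n ∧ A < n ∧ (A : ℝ) ≤ ε * n := fun A => by
    have h1 : Tendsto (fun n : ℕ => ε * (n : ℝ)) atTop atTop :=
      tendsto_natCast_atTop_atTop.const_mul_atTop hε
    exact (hP.and ((eventually_gt_atTop A).and (h1.eventually_ge_atTop (A : ℝ)))).exists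
  choose F hF1 hF2 hF3 using hlarge
  let N : ℕ → ℕ := fun k => Nat.rec (F 1) (fun _ n => F (n + xi n + 1)) k
  refine ⟨N, ?_, hF2 1, by have := hF3 1; rwa [Nat.cast_one] at this,
    fun k => hF2 _, fun k => ?_⟩
  · rintro (_ | k)
    · exact hF1 _
    · exact hF1 _
  · have := hF3 (N k + xi (N k) + 1)
    push_cast at this
    exact this

/-- The growth estimate for the digit sets of `exists_digitSets`, in logarithmic form. -/
theorem sum_log_digitSets_ge {a h : ℕ → ℝ} {lam xi N : ℕ → ℕ} {G T ε : ℝ} (ha : ∀ i, 0 ≤ a i)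
    (hG : 0 ≤ G) (hT : 0 ≤ T) (hTG : T ≤ G)
    (hN0 : 1 ≤ N 0) (hN0ε : 1 ≤ ε * N 0) (hN : ∀ k, N k + xi (N k) + 1 < N (k + 1))
    (hNε : ∀ k, (N k + xi (N k) : ℝ) + 1 ≤ ε * N (k + 1))
    (hwin : ∀ k, ∀ j ≤ xi (N k), T * (N k + j) ≤
      (1 - ε) * N k * G + ∑ i ∈ Finset.Ico (lam (N k)) j, h i)
    (hrow : ∀ k, ∀ r < xi (N k), lam (N k) ≤ r → a (N k + r) = h r)
    (hfree : ∀ i, (∀ k, i + 1 ≠ N k) → (∀ k, N k ≤ i → N k + xi (N k) ≤ i) → a i = G) (M : ℕ) :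
    T * M - T * N 0 ≤ ∑ i ∈ Finset.range M, a i := by
  have hmono : StrictMono N := strictMono_nat_of_lt_succ fun k => by have := hN k; omega
  have hgap : ∀ {k l}, k < l → N k + xi (N k) + 1 < N l := fun {k l} hkl =>
    (hN k).trans_le (hmono.monotone hkl)
  have hsplit : ∀ {m n}, m ≤ n → ∑ i ∈ Finset.range n, a i =
      ∑ i ∈ Finset.range m, a i + ∑ i ∈ Finset.Ico m n, a i := fun {m n} hmn =>
    (Finset.sum_range_add_sum_Ico _ hmn).symm
  have hnonneg : ∀ m, 0 ≤ ∑ i ∈ Finset.range m, a i := fun m => Finset.sum_nonneg fun i _ => ha i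
  have hfreeSum : ∀ {m n}, m ≤ n → (∀ i, m ≤ i → i < n → a i = G) →
      ∑ i ∈ Finset.Ico m n, a i = ((n : ℝ) - m) * G := by
    intro m n hmn hi
    rw [Finset.sum_congr rfl fun i hi' => hi i (Finset.mem_Ico.1 hi').1 (Finset.mem_Ico.1 hi').2,
      Finset.sum_const, Nat.card_Ico, nsmul_eq_mul, Nat.cast_sub hmn]
  have hfreeGap : ∀ k i, N k + xi (N k) ≤ i → i + 1 < N (k + 1) → a i = G := by
    intro k i hi hi'
    refine hfree i (fun l => ?_) fun l hl => ?_
    · rcases Nat.lt_or_ge k l with h | h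
      · have := hmono.monotone (show k + 1 ≤ l from h)
        omega
      · have := hmono.monotone h
        omega
    · rcases Nat.lt_or_ge k l with h | h
      · have := hmono.monotone (show k + 1 ≤ l from h)
        omega
      · rcases h.eq_or_lt with rfl | h
        · exact hi
        · have := hgap h
          omega
  have hstart : ∀ k, (1 - ε) * N k * G ≤ ∑ i ∈ Finset.range (N k), a i := by
    rintro (_ | k)
    · have h1 := hsplit (Nat.sub_le (N 0) 1)
      have h2 := hfreeSum (Nat.zero_le (N 0 - 1)) fun i _ hi => hfree i
        (fun k => by have := hmono.monotone (Nat.zero_le k); omega)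
        (fun k => by have := hmono.monotone (Nat.zero_le k); omega)
      rw [← Finset.range_eq_Ico] at h2
      have h3 : 0 ≤ ∑ i ∈ Finset.Ico (N 0 - 1) (N 0), a i := Finset.sum_nonneg fun i _ => ha i
      push_cast [Nat.cast_sub hN0] at h2
      nlinarith
    · have h0 := hN k
      have h1 := hsplit (Nat.sub_le (N (k + 1)) 1)
      have h1' := hsplit (show N k + xi (N k) ≤ N (k + 1) - 1 by omega)
      have h2 := hfreeSum (show N k + xi (N k) ≤ N (k + 1) - 1 by omega) fun i hi hi' =>
        hfreeGap k i hi (by omega)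
      have h3 : 0 ≤ ∑ i ∈ Finset.Ico (N (k + 1) - 1) (N (k + 1)), a i :=
        Finset.sum_nonneg fun i _ => ha i
      have h4 := hNε k
      push_cast [Nat.cast_sub (show 1 ≤ N (k + 1) by omega)] at h2
      have h5 := hnonneg (N k + xi (N k))
      nlinarith
  have hwindow : ∀ k, ∀ j ≤ xi (N k), T * (N k + j) ≤ ∑ i ∈ Finset.range (N k + j), a i := by
    intro k j hj
    have h1 := hstart k
    have h2 := hwin k j hj
    rw [Finset.sum_range_add]
    have h3 : ∑ i ∈ Finset.Ico (lam (N k)) j, h i ≤ ∑ r ∈ Finset.range j, a (N k + r) := by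
      rw [Finset.sum_congr rfl fun i hi => (hrow k i ((Finset.mem_Ico.1 hi).2.trans_le hj)
        (Finset.mem_Ico.1 hi).1).symm]
      exact Finset.sum_le_sum_of_subset_of_nonneg
        (fun i hi => Finset.mem_range.2 (Finset.mem_Ico.1 hi).2) fun i _ _ => ha _
    linarith
  rcases Nat.lt_or_ge M (N 0) with hM | hM
  · have h1 : (M : ℝ) ≤ N 0 := by exact_mod_cast hM.le
    have h2 := hnonneg M
    nlinarith
  · obtain ⟨k, hk, hk'⟩ : ∃ k, N k ≤ M ∧ M < N (k + 1) := by
      have hex : ∃ k, M < N k := ⟨M + 1, (Nat.lt_succ_self M).trans_le (hmono.id_le _)⟩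
      classical
      have hspec := Nat.find_spec hex
      obtain ⟨k, hk⟩ : ∃ k, Nat.find hex = k + 1 := Nat.exists_eq_succ_of_ne_zero fun h0 => by
        rw [h0] at hspec
        omega
      exact ⟨k, not_lt.1 (Nat.find_min hex (by omega)), hk ▸ hspec⟩
    have hN0' : 0 ≤ T * N 0 := by positivity
    rcases Nat.lt_or_ge M (N k + xi (N k)) with h | h
    · have h1 := hwindow k (M - N k) (by omega)
      rw [Nat.add_sub_cancel' hk, Nat.cast_sub hk] at h1
      linarith
    · have h1 := hwindow k _ le_rfl
      have h2 := hfreeSum h fun i hi hi' => hfreeGap k i hi (by omega)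
      rw [hsplit h, h2]
      have h3 : ((N k + xi (N k) : ℕ) : ℝ) ≤ M := by exact_mod_cast h
      push_cast at h3 ⊢
      nlinarith

theorem mem_targetSet_of_digits (hb : 2 ≤ b) (hJ : ∀ e ∈ J, e.1 < b ∧ e.2 < b) (R : RepMap b J)
    {lam xi : ℕ → ℕ} {z w : ℝ} (hzw : (z, w) ∈ carpet b J) {d : ℕ → ℕ × ℕ} (hd : ∀ i, d i ∈ J)
    (hinf : ∀ e ∈ J, ∃ᶠ i in atTop, d i = e)
    (hmatch : ∃ᶠ n in atTop, (∀ i < lam n, (d (n + i)).1 = (R.rep (z, w) (i + 1)).1) ∧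
      ∀ i < xi n, (d (n + i)).2 = (R.rep (z, w) (i + 1)).2) :
    point b d ∈ targetSet R lam xi z w := by
  refine ⟨point_mem_carpet hd, hmatch.mono fun n hn => ?_⟩
  have hp := point_rep R hzw
  have h1 : (expansion b fun i => (R.rep (z, w) (i + 1)).1) = z := congrArg Prod.fst hp
  have h2 : (expansion b fun i => (R.rep (z, w) (i + 1)).2) = w := congrArg Prod.snd hp
  have h3 := abs_expansion_sub_le hb (u := fun i => (d (i + n)).1) (fun i => (hJ _ (hd _)).1)
    (fun i => (hJ _ (rep_succ_mem R hzw i)).1) (lam n) fun i hi => by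
      rw [add_comm]
      exact hn.1 i hi
  have h4 := abs_expansion_sub_le hb (u := fun i => (d (i + n)).2) (fun i => (hJ _ (hd _)).2)
    (fun i => (hJ _ (rep_succ_mem R hzw i)).2) (xi n) fun i hi => by
      rw [add_comm]
      exact hn.2 i hi
  rw [h1, abs_le] at h3
  rw [h2, abs_le] at h4
  rw [iterate_Tmap_point hb hJ R hd hinf, zpow_neg, zpow_neg, zpow_natCast, zpow_natCast]
  exact ⟨⟨by simp only [point]; linarith, by simp only [point]; linarith⟩,
    ⟨by simp only [point]; linarith, by simp only [point]; linarith⟩⟩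

theorem le_dimH_targetSet (hb : 2 ≤ b) (hJ : ∀ e ∈ J, e.1 < b ∧ e.2 < b) (R : RepMap b J)
    {lam xi : ℕ → ℕ} (hle : ∀ n, lam n ≤ xi n) {z w : ℝ} (hzw : (z, w) ∈ carpet b J) {t ε : ℝ}
    (ht : 0 < t) (hε : 0 < ε) (htJ : t * Real.log b ≤ Real.log J.card)
    (hwin : ∀ᶠ n : ℕ in atTop, ∀ j ≤ xi n, t * Real.log b * (n + j) ≤
      (1 - ε) * n * Real.log J.card +
        ∑ i ∈ Finset.Ico (lam n) j, Real.log (J2 J (R.rep (z, w) (i + 1)).2).card) :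
    ENNReal.ofReal t ≤ dimH (targetSet R lam xi z w) := by
  have hgJ := rep_succ_mem R hzw
  have hJne : J.Nonempty := ⟨_, hgJ 0⟩
  have hrowne : ∀ i, R.rep (z, w) (i + 1) ∈ J2 J (R.rep (z, w) (i + 1)).2 := fun i =>
    Finset.mem_filter.2 ⟨hgJ i, rfl⟩
  have hb1 : (1 : ℝ) < b := by exact_mod_cast hb
  have hlogb : 0 < Real.log b := Real.log_pos hb1
  obtain ⟨e, heJ, he⟩ := exists_recurrent_enumeration hJne
  obtain ⟨N, hNwin, hN0, hN0ε, hN, hNε⟩ := exists_sparse_sequence hwin xi hε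
  obtain ⟨D, hD1, hD2, hD3, hD4⟩ := exists_digitSets J e (fun i => R.rep (z, w) (i + 1)) lam xi N
    hN hle (by omega)
  have hmono : StrictMono N := strictMono_nat_of_lt_succ fun k => by have := hN k; omega
  have hcases : ∀ i, (D i).Nonempty ∧ D i ⊆ J := by
    intro i
    by_cases h1 : ∃ k, i + 1 = N k
    · obtain ⟨k, hk⟩ := h1
      rw [show i = N k - 1 by omega, hD1]
      exact ⟨Finset.singleton_nonempty _, Finset.singleton_subset_iff.2 (heJ k)⟩
    by_cases h2 : ∃ k, N k ≤ i ∧ i < N k + xi (N k)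
    · obtain ⟨k, hk, hk'⟩ := h2
      obtain ⟨r, rfl⟩ := Nat.exists_eq_add_of_le hk
      rcases Nat.lt_or_ge r (lam (N k)) with h | h
      · rw [hD2 k r h]
        exact ⟨Finset.singleton_nonempty _, Finset.singleton_subset_iff.2 (hgJ r)⟩
      · rw [hD3 k r (by omega) h]
        exact ⟨⟨_, hrowne r⟩, Finset.filter_subset _ _⟩
    · rw [hD4 i (fun k hk => h1 ⟨k, hk⟩)
        fun k hk => not_lt.1 fun hk' => h2 ⟨k, hk, hk'⟩]
      exact ⟨hJne, subset_rfl⟩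
  have hcard : ∀ i, (1 : ℝ) ≤ (D i).card := fun i => by exact_mod_cast (hcases i).1.card_pos
  have hsum := sum_log_digitSets_ge (a := fun i => Real.log (D i).card)
    (fun i => Real.log_nonneg (hcard i)) (Real.log_natCast_nonneg _) (by positivity) htJ
    (by omega) hN0ε hN hNε hNwin (fun k r hr hr' => by simp only [hD3 k r hr hr'])
    (fun i h1 h2 => by simp only [hD4 i h1 h2])
  have hdim := le_dimH_image_point hb (fun i => (hcases i).1)
    (fun i x hx => hJ x ((hcases i).2 hx)) ht (Real.exp_pos (t * Real.log b * N 0)) fun M => by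
      have h1 : ∏ i ∈ Finset.range M, ((D i).card : ℝ) =
          Real.exp (∑ i ∈ Finset.range M, Real.log (D i).card) := by
        rw [Real.exp_sum]
        exact Finset.prod_congr rfl fun i _ => (Real.exp_log (by linarith [hcard i])).symm
      rw [h1, ← Real.exp_add, Real.rpow_def_of_pos (by linarith), Real.exp_le_exp]
      have := hsum M
      linarith
  refine hdim.trans (dimH_mono ?_)
  rintro _ ⟨d, hd, rfl⟩
  refine mem_targetSet_of_digits hb hJ R hzw (fun i => (hcases i).2 (hd i)) ?_ ?_
  · intro x hx
    have hsub : Tendsto (fun k => N k - 1) atTop atTop :=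
      (tendsto_sub_atTop_nat 1).comp hmono.tendsto_atTop
    refine hsub.frequently ((he x hx).mono fun k hk => ?_)
    have h1 := hd (N k - 1)
    rw [hD1, Finset.mem_singleton] at h1
    rw [h1, hk]
  · refine hmono.tendsto_atTop.frequently (Frequently.of_forall fun k => ⟨fun i hi => ?_,
      fun i hi => ?_⟩)
    · have h1 := hd (N k + i)
      rw [hD2 k i hi, Finset.mem_singleton] at h1
      rw [h1]
    · have h1 := hd (N k + i)
      rcases Nat.lt_or_ge i (lam (N k)) with h | h
      · rw [hD2 k i h, Finset.mem_singleton] at h1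
        rw [h1]
      · rw [hD3 k i hi h] at h1
        exact (Finset.mem_filter.1 h1).2

end LowerConstruction

section UpperBound

variable {b : ℕ} {J : Finset (ℕ × ℕ)}

theorem ediam_cylinder_le (hb : 2 ≤ b) {M : ℕ} (u : Fin M → ℕ × ℕ) :
    Metric.ediam {p | ∃ d : ℕ → ℕ × ℕ, (∀ i, (d i).1 < b ∧ (d i).2 < b) ∧ p = point b d ∧
      (fun i : Fin M => d i) = u} ≤ ENNReal.ofReal ((b : ℝ) ^ M)⁻¹ := by
  refine Metric.ediam_le ?_
  rintro _ ⟨d, hd, rfl, hu⟩ _ ⟨d', hd', rfl, hu'⟩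
  have heq : ∀ i < M, d i = d' i := fun i hi => congrFun (hu.trans hu'.symm) ⟨i, hi⟩
  rw [edist_dist]
  refine ENNReal.ofReal_le_ofReal (max_le ?_ ?_)
  · exact abs_expansion_sub_le hb (fun i => (hd i).1) (fun i => (hd' i).1) M
      fun i hi => by rw [heq i hi]
  · exact abs_expansion_sub_le hb (fun i => (hd i).2) (fun i => (hd' i).2) M
      fun i hi => by rw [heq i hi]

/-- A Borel–Cantelli type upper bound for the Hausdorff dimension of a set whose points lie in
infinitely many of the cylinder families `F n`. -/
theorem dimH_le_of_cylinder_cover (hb : 2 ≤ b) {S : Set (ℝ × ℝ)} {M : ℕ → ℕ} (hM : ∀ n, n ≤ M n)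
    (F : ∀ n, Finset (Fin (M n) → ℕ × ℕ))
    (hS : ∀ p ∈ S, ∃ᶠ n in atTop, ∃ d : ℕ → ℕ × ℕ, (∀ i, (d i).1 < b ∧ (d i).2 < b) ∧
      p = point b d ∧ (fun i : Fin (M n) => d i) ∈ F n)
    {s ρ : ℝ} (hs : 0 ≤ s) (hρ0 : 0 ≤ ρ) (hρ1 : ρ < 1)
    (hF : ∀ᶠ n in atTop, ((F n).card : ℝ) * (b : ℝ) ^ (-(s * M n)) ≤ ρ ^ n) :
    dimH S ≤ ENNReal.ofReal s := by
  have hb1 : (1 : ℝ) < b := by exact_mod_cast hb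
  have hb0 : (0 : ℝ) < b := by linarith
  let cyl : ∀ N, (Σ k : ℕ, ↥(F (N + k))) → Set (ℝ × ℝ) := fun N q =>
    {p | ∃ d : ℕ → ℕ × ℕ, (∀ i, (d i).1 < b ∧ (d i).2 < b) ∧ p = point b d ∧
      (fun i : Fin (M (N + q.1)) => d i) = q.2.1}
  have hr : Tendsto (fun N : ℕ => ENNReal.ofReal ((b : ℝ) ^ N)⁻¹) atTop (𝓝 0) := by
    rw [← ENNReal.ofReal_zero]
    refine ENNReal.tendsto_ofReal ?_
    exact (tendsto_pow_atTop_nhds_zero_of_lt_one (inv_nonneg.2 hb0.le)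
      (inv_lt_one_of_one_lt₀ hb1)).congr fun N => inv_pow _ _
  have hdiam : ∀ᶠ N in atTop, ∀ q, Metric.ediam (cyl N q) ≤ ENNReal.ofReal ((b : ℝ) ^ N)⁻¹ :=
    Eventually.of_forall fun N q => (ediam_cylinder_le hb q.2.1).trans
      (ENNReal.ofReal_le_ofReal (inv_anti₀ (by positivity)
        (pow_le_pow_right₀ hb1.le ((Nat.le_add_right N q.1).trans (hM _)))))
  have hcov : ∀ᶠ N in atTop, S ⊆ ⋃ q, cyl N q := Eventually.of_forall fun N p hp => by
    obtain ⟨n, hn, d, hd, hpd, hdF⟩ := frequently_atTop.1 (hS p hp) N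
    obtain ⟨k, rfl⟩ := Nat.exists_eq_add_of_le hn
    exact Set.mem_iUnion.2 ⟨⟨k, ⟨_, hdF⟩⟩, d, hd, hpd, rfl⟩
  have hsum : ∀ᶠ N in atTop, ∑' q, Metric.ediam (cyl N q) ^ s ≤ ENNReal.ofReal (1 - ρ)⁻¹ := by
    obtain ⟨N₀, hN₀⟩ := eventually_atTop.1 hF
    refine eventually_atTop.2 ⟨N₀, fun N hN => ?_⟩
    rw [ENNReal.tsum_sigma']
    have hgeom := hasSum_geometric_of_lt_one hρ0 hρ1
    rw [← hgeom.tsum_eq, ENNReal.ofReal_tsum_of_nonneg (fun n => by positivity) hgeom.summable]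
    refine ENNReal.tsum_le_tsum fun k => ?_
    have hterm : ∀ q : ↥(F (N + k)), Metric.ediam (cyl N ⟨k, q⟩) ^ s ≤
        ENNReal.ofReal ((b : ℝ) ^ (-(s * M (N + k)))) := fun q => by
      refine (ENNReal.rpow_le_rpow (ediam_cylinder_le hb q.1) hs).trans (le_of_eq ?_)
      rw [ENNReal.ofReal_rpow_of_pos (by positivity), ← Real.rpow_natCast,
        ← Real.rpow_neg hb0.le, ← Real.rpow_mul hb0.le]
      congr 2
      ring
    rw [tsum_fintype]
    refine (Finset.sum_le_card_nsmul _ _ _ fun q _ => hterm q).trans ?_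
    rw [Finset.card_univ, Fintype.card_coe, nsmul_eq_mul, ← ENNReal.ofReal_natCast,
      ← ENNReal.ofReal_mul (by positivity)]
    refine ENNReal.ofReal_le_ofReal ((hN₀ (N + k) (by omega)).trans ?_)
    exact pow_le_pow_of_le_one hρ0 hρ1.le (by omega)
  have hmeas := Measure.hausdorffMeasure_le_liminf_tsum s S _ hr cyl hdiam hcov
  have hlim : liminf (fun N => ∑' q, Metric.ediam (cyl N q) ^ s) atTop ≤
      ENNReal.ofReal (1 - ρ)⁻¹ := (liminf_le_liminf hsum).trans (liminf_const _).le
  have hne : μH[(s.toNNReal : ℝ)] S ≠ ∞ := by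
    rw [Real.coe_toNNReal s hs]
    exact ne_top_of_le_ne_top ENNReal.ofReal_ne_top (hmeas.trans hlim)
  exact dimH_le_of_hausdorffMeasure_ne_top hne

theorem prod_range_add_piecewise (J : Finset (ℕ × ℕ)) (e : ℕ → ℕ × ℕ) {n k L : ℕ} (hk : k ≤ L) :
    ∏ i ∈ Finset.range (n + L), (if i < n then J else if i - n < k then {e (i - n)}
      else J2 J (e (i - n)).2).card = J.card ^ n * ∏ i ∈ Finset.Ico k L, (J2 J (e i).2).card := by
  rw [Finset.prod_range_add]
  congr 1
  · rw [Finset.prod_congr rfl fun i hi => by rw [if_pos (Finset.mem_range.1 hi)]]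
    simp
  · rw [← Finset.prod_range_mul_prod_Ico _ hk, Finset.prod_eq_one, one_mul]
    · refine Finset.prod_congr rfl fun i hi => ?_
      rw [if_neg (by omega), Nat.add_sub_cancel_left, if_neg (by
        have := (Finset.mem_Ico.1 hi).1
        omega)]
    · intro i hi
      rw [if_neg (by omega), Nat.add_sub_cancel_left, if_pos (Finset.mem_range.1 hi),
        Finset.card_singleton]

/-- Words of length `n + L` in `J` with prescribed first-coordinate digits for `k` steps after
time `n` and prescribed second-coordinate digits for `L` steps after time `n`. -/
theorem exists_words_of_eq_prefixes (hJ : ∀ e ∈ J, e.1 < b ∧ e.2 < b) {n k L : ℕ} (hk : k ≤ L)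
    (X Y : ℤ) {B : ℝ} (hB0 : 0 ≤ B)
    (hB : ∀ e : ℕ → ℕ × ℕ, (∀ i, e i ∈ J) → (prefixInt b (fun i => (e i).2) L : ℤ) = Y →
      ∏ i ∈ Finset.Ico k L, ((J2 J (e i).2).card : ℝ) ≤ B) :
    ∃ F : Finset (Fin (n + L) → ℕ × ℕ), (F.card : ℝ) ≤ J.card ^ n * B ∧
      ∀ d : ℕ → ℕ × ℕ, (∀ i, d i ∈ J) → (prefixInt b (fun i => (d (i + n)).1) k : ℤ) = X →
        (prefixInt b (fun i => (d (i + n)).2) L : ℤ) = Y → (fun i : Fin (n + L) => d i) ∈ F := by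
  by_cases h : ∃ e : ℕ → ℕ × ℕ, (∀ i, e i ∈ J) ∧ (prefixInt b (fun i => (e i).1) k : ℤ) = X ∧
    (prefixInt b (fun i => (e i).2) L : ℤ) = Y
  · obtain ⟨e, heJ, heX, heY⟩ := h
    refine ⟨Fintype.piFinset fun i : Fin (n + L) => if (i : ℕ) < n then J else
      if (i : ℕ) - n < k then {e (i - n)} else J2 J (e (i - n)).2, ?_, fun d hd hX hY => ?_⟩
    · rw [Fintype.card_piFinset, Fin.prod_univ_eq_prod_range (fun i => (if i < n then J else
        if i - n < k then {e (i - n)} else J2 J (e (i - n)).2).card) (n + L),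
        prod_range_add_piecewise J e hk]
      push_cast
      exact mul_le_mul_of_nonneg_left (hB e heJ heY) (by positivity)
    · refine Fintype.mem_piFinset.2 fun i => ?_
      have hx := digit_eq_of_prefixInt_eq (fun i => (hJ _ (hd (i + n))).1)
        (fun i => (hJ _ (heJ i)).1) k (by omega) (i - n)
      have hy := digit_eq_of_prefixInt_eq (fun i => (hJ _ (hd (i + n))).2)
        (fun i => (hJ _ (heJ i)).2) L (by omega) (i - n)
      have hi := i.2
      split_ifs with h1 h2
      · exact hd i
      · rw [Nat.sub_add_cancel (not_lt.1 h1)] at hx hy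
        exact Finset.mem_singleton.2 (Prod.ext (hx h2) (hy (by omega)))
      · rw [Nat.sub_add_cancel (not_lt.1 h1)] at hy
        exact Finset.mem_filter.2 ⟨hd i, hy (by omega)⟩
  · refine ⟨∅, by rw [Finset.card_empty, Nat.cast_zero]; positivity, fun d hd hX hY => ?_⟩
    exact absurd ⟨fun i => d (i + n), fun i => hd _, hX, hY⟩ h

theorem exists_words_of_prefix_close (hJ : ∀ e ∈ J, e.1 < b ∧ e.2 < b) {n k L : ℕ} (hk : k ≤ L)
    (X Y : ℤ) {B : ℝ} (hB0 : 0 ≤ B)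
    (hB : ∀ e : ℕ → ℕ × ℕ, (∀ i, e i ∈ J) →
      |(prefixInt b (fun i => (e i).2) L : ℤ) - Y| ≤ 1 →
      ∏ i ∈ Finset.Ico k L, ((J2 J (e i).2).card : ℝ) ≤ B) :
    ∃ F : Finset (Fin (n + L) → ℕ × ℕ), (F.card : ℝ) ≤ 9 * (J.card ^ n * B) ∧
      ∀ d : ℕ → ℕ × ℕ, (∀ i, d i ∈ J) →
        |(prefixInt b (fun i => (d (i + n)).1) k : ℤ) - X| ≤ 1 →
        |(prefixInt b (fun i => (d (i + n)).2) L : ℤ) - Y| ≤ 1 →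
        (fun i : Fin (n + L) => d i) ∈ F := by
  classical
  have hex : ∀ q : ℤ × ℤ, ∃ F : Finset (Fin (n + L) → ℕ × ℕ),
      |q.2 - Y| ≤ 1 → (F.card : ℝ) ≤ J.card ^ n * B ∧
      ∀ d : ℕ → ℕ × ℕ, (∀ i, d i ∈ J) → (prefixInt b (fun i => (d (i + n)).1) k : ℤ) = q.1 →
        (prefixInt b (fun i => (d (i + n)).2) L : ℤ) = q.2 →
        (fun i : Fin (n + L) => d i) ∈ F := by
    intro q
    by_cases hq : |q.2 - Y| ≤ 1
    · obtain ⟨F, hF⟩ := exists_words_of_eq_prefixes hJ (n := n) hk q.1 q.2 hB0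
        fun e he heq => hB e he (by rwa [heq])
      exact ⟨F, fun _ => hF⟩
    · exact ⟨∅, fun h => absurd h hq⟩
  choose F hF using hex
  refine ⟨(Finset.Icc (X - 1) (X + 1) ×ˢ Finset.Icc (Y - 1) (Y + 1)).biUnion F, ?_,
    fun d hd hX hY => ?_⟩
  · have h1 : ((Finset.Icc (X - 1) (X + 1) ×ˢ Finset.Icc (Y - 1) (Y + 1)).card : ℝ) = 9 := by
      rw [Finset.card_product, Int.card_Icc, Int.card_Icc,
        show (X + 1 + 1 - (X - 1)).toNat = 3 by omega,
        show (Y + 1 + 1 - (Y - 1)).toNat = 3 by omega]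
      norm_num
    calc (((Finset.Icc (X - 1) (X + 1) ×ˢ Finset.Icc (Y - 1) (Y + 1)).biUnion F).card : ℝ)
        ≤ ∑ q ∈ Finset.Icc (X - 1) (X + 1) ×ˢ Finset.Icc (Y - 1) (Y + 1), ((F q).card : ℝ) := by
          exact_mod_cast Finset.card_biUnion_le
      _ ≤ _ := Finset.sum_le_card_nsmul _ _ _ fun q hq => (hF q (by
          have := Finset.mem_Icc.1 (Finset.mem_product.1 hq).2
          rw [abs_le]
          omega)).1
      _ = _ := by rw [nsmul_eq_mul, h1]
  · refine Finset.mem_biUnion.2 ⟨((prefixInt b (fun i => (d (i + n)).1) k : ℤ),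
      (prefixInt b (fun i => (d (i + n)).2) L : ℤ)), ?_, (hF _ hY).2 d hd rfl rfl⟩
    rw [abs_le] at hX hY
    rw [Finset.mem_product, Finset.mem_Icc, Finset.mem_Icc]
    exact ⟨⟨by linarith, by linarith⟩, by linarith, by linarith⟩

/-- The upper bound for the dimension of the target set obtained by covering at the scale
`b ^ -(n + L n)`, where `λ n - 1 ≤ L n ≤ ξ n - 1`. -/
theorem dimH_targetSet_le (hb : 2 ≤ b) (hJ : ∀ e ∈ J, e.1 < b ∧ e.2 < b) (R : RepMap b J)
    {lam xi L : ℕ → ℕ} (hlam : ∀ n, 1 ≤ lam n) (hlamL : ∀ n, lam n ≤ L n + 1)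
    (hLxi : ∀ n, L n + 1 ≤ xi n) {z w : ℝ} (hzw : (z, w) ∈ carpet b J) {l τ c s : ℝ}
    (hl : Tendsto (fun n : ℕ => (lam n : ℝ) / n) atTop (𝓝 l))
    (hL : Tendsto (fun n : ℕ => (L n : ℝ) / n) atTop (𝓝 τ))
    (hrow : ∀ ε > 0, ∃ C : ℝ, ∀ (M : ℕ) (e : ℕ → ℕ × ℕ), (∀ i, e i ∈ J) →
      |(prefixInt b (fun i => (e i).2) M : ℤ) -
        prefixInt b (fun i => (R.rep (z, w) (i + 1)).2) M| ≤ 1 →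
      ∀ k ≤ M, ∑ i ∈ Finset.Ico k M, Real.log (J2 J (e i).2).card ≤
        ((M : ℝ) - k) * c + ε * M + C)
    (hs0 : 0 ≤ s) (hs : Real.log J.card + (τ - l) * c < s * (1 + τ) * Real.log b) :
    dimH (targetSet R lam xi z w) ≤ ENNReal.ofReal s := by
  have hb1 : (1 : ℝ) < b := by exact_mod_cast hb
  have hb0 : (0 : ℝ) < b := by linarith
  have hgJ := rep_succ_mem R hzw
  have hJpos : (0 : ℝ) < J.card := by exact_mod_cast Finset.card_pos.2 ⟨_, hgJ 0⟩
  have hτ : 0 ≤ τ := ge_of_tendsto' hL fun n => by positivity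
  set gap := s * (1 + τ) * Real.log b - (Real.log J.card + (τ - l) * c) with hgap
  have hgap0 : 0 < gap := by linarith
  obtain ⟨C, hC⟩ := hrow (gap / (2 * (τ + 1))) (by positivity)
  set ε := gap / (2 * (τ + 1)) with hε
  have hετ : ε * τ < gap / 2 := by
    have : ε * (τ + 1) = gap / 2 := by
      rw [hε]
      field_simp
    have hε0 : 0 < ε := by positivity
    linarith
  let E : ℕ → ℝ := fun n => ((L n : ℝ) - (lam n - 1 : ℕ)) * c + ε * L n + C
  have hcover : ∀ n, ∃ F : Finset (Fin (n + L n) → ℕ × ℕ),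
      (F.card : ℝ) ≤ 9 * (J.card ^ n * Real.exp (E n)) ∧
      ∀ d : ℕ → ℕ × ℕ, (∀ i, d i ∈ J) →
        |(prefixInt b (fun i => (d (i + n)).1) (lam n - 1) : ℤ) -
          prefixInt b (fun i => (R.rep (z, w) (i + 1)).1) (lam n - 1)| ≤ 1 →
        |(prefixInt b (fun i => (d (i + n)).2) (L n) : ℤ) -
          prefixInt b (fun i => (R.rep (z, w) (i + 1)).2) (L n)| ≤ 1 →
        (fun i : Fin (n + L n) => d i) ∈ F := fun n => by
    have hk : lam n - 1 ≤ L n := by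
      have := hlamL n
      omega
    refine exists_words_of_prefix_close hJ hk _ _ (Real.exp_pos _).le fun e he hclose => ?_
    have h1 : ∀ i, (0 : ℝ) < (J2 J (e i).2).card := fun i => by
      have h0 : e i ∈ J2 J (e i).2 := Finset.mem_filter.2 ⟨he i, rfl⟩
      exact_mod_cast Finset.card_pos.2 ⟨_, h0⟩
    rw [Finset.prod_congr rfl fun i _ => (Real.exp_log (h1 i)).symm, ← Real.exp_sum,
      Real.exp_le_exp]
    exact hC (L n) e he hclose _ hk
  choose F hFcard hF using hcover
  refine dimH_le_of_cylinder_cover hb (M := fun n => n + L n) (fun n => Nat.le_add_right _ _) F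
    ?_ hs0 (Real.exp_pos (-(gap / 2))).le (Real.exp_lt_one_iff.2 (by linarith)) ?_
  · rintro p ⟨hp, hfreq⟩
    refine hfreq.mono fun n hn => ?_
    obtain ⟨d, hd, hpd, hT⟩ := exists_digits_iterate hb hJ R n p hp
    refine ⟨d, fun i => hJ _ (hd i), hpd, hF n d hd ?_ ?_⟩
    · have h1 : (expansion b fun i => (R.rep (z, w) (i + 1)).1) = z :=
        congrArg Prod.fst (point_rep R hzw)
      refine prefixInt_close hb (fun i => (hJ _ (hd _)).1) (fun i => (hJ _ (hgJ i)).1) _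
        (pow_mul_abs_sub_lt_one hb ?_)
      have h2 := hn.1
      rw [hT, zpow_neg, zpow_natCast] at h2
      simp only [point, Set.mem_Icc] at h2
      rw [h1, Nat.sub_add_cancel (hlam n), abs_le]
      constructor <;> linarith [h2.1, h2.2]
    · have h1 : (expansion b fun i => (R.rep (z, w) (i + 1)).2) = w :=
        congrArg Prod.snd (point_rep R hzw)
      refine prefixInt_close hb (fun i => (hJ _ (hd _)).2) (fun i => (hJ _ (hgJ i)).2) _
        (pow_mul_abs_sub_lt_one hb ?_)
      have h2 := hn.2
      rw [hT, zpow_neg, zpow_natCast] at h2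
      simp only [point, Set.mem_Icc] at h2
      have h3 : ((b : ℝ) ^ xi n)⁻¹ ≤ ((b : ℝ) ^ (L n + 1))⁻¹ :=
        inv_anti₀ (by positivity) (pow_le_pow_right₀ hb1.le (hLxi n))
      rw [h1, abs_le]
      constructor <;> linarith [h2.1, h2.2]
  · have hinv : Tendsto (fun n : ℕ => (1 : ℝ) / n) atTop (𝓝 0) := tendsto_one_div_atTop_nhds_zero_nat
    have hlim : Tendsto (fun n : ℕ => Real.log J.card + ((L n : ℝ) / n - lam n / n) * c +
        ε * ((L n : ℝ) / n) + (Real.log 9 + C + c) * (1 / n) -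
        s * (1 + (L n : ℝ) / n) * Real.log b) atTop
        (𝓝 (Real.log J.card + (τ - l) * c + ε * τ + (Real.log 9 + C + c) * 0 -
          s * (1 + τ) * Real.log b)) :=
      ((((tendsto_const_nhds.add ((hL.sub hl).mul_const c)).add (hL.const_mul ε)).add
        (hinv.const_mul _)).sub (((tendsto_const_nhds.add hL).const_mul s).mul_const _))
    filter_upwards [hlim.eventually_lt_const (show _ < -(gap / 2) by linarith),
      eventually_gt_atTop 0] with n hn hn0
    have hn0' : (0 : ℝ) < n := by exact_mod_cast hn0
    have hkey : Real.log 9 + (n * Real.log J.card + E n) - Real.log b * (s * ((n + L n : ℕ) : ℝ)) ≤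
        -(gap / 2) * n := by
      have h1 := mul_le_mul_of_nonneg_right hn.le hn0'.le
      refine le_trans (le_of_eq ?_) h1
      simp only [E]
      rw [Nat.cast_sub (hlam n)]
      push_cast
      field_simp
      ring
    calc ((F n).card : ℝ) * (b : ℝ) ^ (-(s * ((n + L n : ℕ) : ℝ)))
        ≤ 9 * (J.card ^ n * Real.exp (E n)) * (b : ℝ) ^ (-(s * ((n + L n : ℕ) : ℝ))) := by
          gcongr
          exact hFcard n
      _ = Real.exp (Real.log 9 + (n * Real.log J.card + E n) -
            Real.log b * (s * ((n + L n : ℕ) : ℝ))) := by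
          generalize E n = y
          rw [sub_eq_add_neg, Real.exp_add, Real.exp_add, Real.exp_add, Real.exp_log (by norm_num),
            Real.exp_nat_mul, Real.exp_log hJpos, Real.rpow_def_of_pos hb0, mul_neg]
      _ ≤ Real.exp (-(gap / 2)) ^ n := by
          rw [← Real.exp_nat_mul, Real.exp_le_exp]
          linarith

end UpperBound

section RowEstimates

variable {b : ℕ} {J : Finset (ℕ × ℕ)}

theorem le_linear_of_tendsto_div_zero {u : ℕ → ℝ}
    (h : Tendsto (fun n : ℕ => u n / n) atTop (𝓝 0)) {ε : ℝ} (hε : 0 < ε) :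
    ∃ C : ℝ, 0 ≤ C ∧ ∀ n : ℕ, u n ≤ ε * n + C := by
  obtain ⟨N, hN⟩ := eventually_atTop.1
    ((h.eventually_lt_const hε).and (eventually_gt_atTop 0))
  have hC : 0 ≤ ∑ i ∈ Finset.range N, |u i| := Finset.sum_nonneg fun i _ => abs_nonneg _
  refine ⟨∑ i ∈ Finset.range N, |u i|, hC, fun n => ?_⟩
  rcases lt_or_ge n N with hn | hn
  · have h1 : |u n| ≤ ∑ i ∈ Finset.range N, |u i| :=
      Finset.single_le_sum (f := fun i => |u i|) (fun i _ => abs_nonneg _) (Finset.mem_range.2 hn)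
    have h2 : 0 ≤ ε * n := by positivity
    linarith [le_abs_self (u n)]
  · obtain ⟨h1, h2⟩ := hN n hn
    have h3 : (0 : ℝ) < n := by exact_mod_cast h2
    have := (div_lt_iff₀ h3).1 h1
    linarith

theorem log_card_nonneg (s : Finset (ℕ × ℕ)) : 0 ≤ Real.log s.card :=
  Real.log_natCast_nonneg _

theorem log_card_J2_le (a : ℕ) : Real.log (J2 J a).card ≤ Real.log J.card := by
  rcases Nat.eq_zero_or_pos (J2 J a).card with h | h
  · rw [h]
    simpa using log_card_nonneg J
  · exact Real.log_le_log (by exact_mod_cast h)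
      (by exact_mod_cast Finset.card_le_card (Finset.filter_subset _ _))

/-- A digit string in `J` whose rows are `b`-adically adjacent to those of `g` uses rows with more
than `#J₂(a)` digits only rarely. -/
theorem exists_small_exceptional_set (hb : 2 ≤ b) (hJ : ∀ e ∈ J, e.1 < b ∧ e.2 < b) {a a' : ℕ}
    (haa' : a = 0 ∧ a' = b - 1 ∨ a = b - 1 ∧ a' = 0) {g : ℕ → ℕ × ℕ} (hg : ∀ i, g i ∈ J)
    (hfreq : ∀ ε : ℝ, 0 < ε → ∃ C : ℝ, ∀ L : ℕ,
      (((Finset.range L).filter fun i => (g i).2 ≠ a).card : ℝ) ≤ ε * L + C)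
    (hrun : (J2 J a').card ≤ (J2 J a).card ∨ ∀ ε : ℝ, 0 < ε → ∃ C : ℝ, 0 ≤ C ∧ ∀ j L : ℕ,
      (∀ i, j < i → i < L → (g i).2 = a) → (L : ℝ) - j ≤ ε * L + C)
    {ε : ℝ} (hε : 0 < ε) :
    ∃ C : ℝ, ∀ (M : ℕ) (e : ℕ → ℕ × ℕ), (∀ i, e i ∈ J) →
      |(prefixInt b (fun i => (e i).2) M : ℤ) - prefixInt b (fun i => (g i).2) M| ≤ 1 →
      ∃ B : Finset ℕ, (B.card : ℝ) ≤ ε * M + C ∧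
        ∀ i, i < M → i ∉ B → Real.log (J2 J (e i).2).card ≤ Real.log (J2 J a).card := by
  obtain ⟨C₁, hC₁⟩ := hfreq (ε / 2) (half_pos hε)
  obtain ⟨C₂, hC₂, hrun'⟩ : ∃ C : ℝ, 0 ≤ C ∧ ((J2 J a').card ≤ (J2 J a).card ∨ ∀ j L : ℕ,
      (∀ i, j < i → i < L → (g i).2 = a) → (L : ℝ) - j ≤ ε / 2 * L + C) := by
    rcases hrun with h | h
    · exact ⟨0, le_rfl, Or.inl h⟩
    · obtain ⟨C, hC, h'⟩ := h (ε / 2) (half_pos hε)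
      exact ⟨C, hC, Or.inr h'⟩
  refine ⟨C₁ + C₂ + 1, fun M e he hclose => ?_⟩
  have hM : 0 ≤ ε / 2 * M := by positivity
  set B := (Finset.range M).filter fun i => (g i).2 ≠ a with hB
  have hBcard := hC₁ M
  rw [← hB] at hBcard
  have hmem : ∀ i, i < M → i ∉ B → (g i).2 = a := fun i hi hiB => by
    by_contra h
    exact hiB (Finset.mem_filter.2 ⟨Finset.mem_range.2 hi, h⟩)
  rcases digits_of_prefixInt_close (fun i => (hJ _ (he i)).2) (fun i => (hJ _ (hg i)).2) M hclose
    with h | ⟨j, hj, hpre, -, htail⟩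
  · refine ⟨B, by linarith, fun i hi hiB => ?_⟩
    rw [h i hi, hmem i hi hiB]
  have hjB : ((insert j B).card : ℝ) ≤ B.card + 1 := by exact_mod_cast Finset.card_insert_le j B
  have htail' : (∀ i, j < i → i < M → (e i).2 = a' ∧ (g i).2 = a) ∨
      ∀ i, j < i → i < M → (g i).2 ≠ a := by
    rcases haa' with ⟨rfl, rfl⟩ | ⟨rfl, rfl⟩ <;> rcases htail with ht | ht
    · right
      intro i h1 h2
      have := (ht i h1 h2).2
      omega
    · exact Or.inl ht
    · exact Or.inl ht
    · right
      intro i h1 h2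
      have := (ht i h1 h2).2
      omega
  have hbefore : ∀ i, i < M → i ∉ B → i < j →
      Real.log (J2 J (e i).2).card ≤ Real.log (J2 J a).card := fun i hi hiB hij => by
    rw [hpre i hij, hmem i hi hiB]
  rcases htail' with ht | ht
  · rcases hrun' with hle | hr
    · refine ⟨insert j B, by linarith, fun i hi hiB => ?_⟩
      rw [Finset.mem_insert, not_or] at hiB
      rcases lt_or_gt_of_ne hiB.1 with hij | hij
      · exact hbefore i hi hiB.2 hij
      · have h0 : e i ∈ J2 J a' := Finset.mem_filter.2 ⟨he i, (ht i hij hi).1⟩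
        rw [(ht i hij hi).1]
        exact Real.log_le_log (by exact_mod_cast Finset.card_pos.2 ⟨_, h0⟩) (by exact_mod_cast hle)
    · refine ⟨insert j B ∪ Finset.Ico (j + 1) M, ?_, fun i hi hiB => ?_⟩
      · have h1 : ((insert j B ∪ Finset.Ico (j + 1) M).card : ℝ) ≤
            (insert j B).card + (Finset.Ico (j + 1) M).card := by
          exact_mod_cast Finset.card_union_le _ _
        have h2 := hr j M fun i h1 h2 => (ht i h1 h2).2
        rw [Nat.card_Ico, Nat.cast_sub hj, Nat.cast_succ] at h1
        linarith
      · simp only [Finset.mem_union, Finset.mem_insert, Finset.mem_Ico, not_or] at hiB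
        exact hbefore i hi hiB.1.2 (by omega)
  · refine ⟨insert j B, by linarith, fun i hi hiB => ?_⟩
    rw [Finset.mem_insert, not_or] at hiB
    rcases lt_or_gt_of_ne hiB.1 with hij | hij
    · exact hbefore i hi hiB.2 hij
    · exact absurd (hmem i hi hiB.2) (ht i hij hi)

theorem exists_sum_log_row_le (hb : 2 ≤ b) (hJ : ∀ e ∈ J, e.1 < b ∧ e.2 < b) {a a' : ℕ}
    (haa' : a = 0 ∧ a' = b - 1 ∨ a = b - 1 ∧ a' = 0) {g : ℕ → ℕ × ℕ} (hg : ∀ i, g i ∈ J)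
    (hfreq : ∀ ε : ℝ, 0 < ε → ∃ C : ℝ, ∀ L : ℕ,
      (((Finset.range L).filter fun i => (g i).2 ≠ a).card : ℝ) ≤ ε * L + C)
    (hrun : (J2 J a').card ≤ (J2 J a).card ∨ ∀ ε : ℝ, 0 < ε → ∃ C : ℝ, 0 ≤ C ∧ ∀ j L : ℕ,
      (∀ i, j < i → i < L → (g i).2 = a) → (L : ℝ) - j ≤ ε * L + C)
    {ε : ℝ} (hε : 0 < ε) :
    ∃ C : ℝ, ∀ (M : ℕ) (e : ℕ → ℕ × ℕ), (∀ i, e i ∈ J) →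
      |(prefixInt b (fun i => (e i).2) M : ℤ) - prefixInt b (fun i => (g i).2) M| ≤ 1 →
      ∀ k ≤ M, ∑ i ∈ Finset.Ico k M, Real.log (J2 J (e i).2).card ≤
        ((M : ℝ) - k) * Real.log (J2 J a).card + ε * M + C := by
  have hK := log_card_nonneg J
  obtain ⟨C, hC⟩ := exists_small_exceptional_set hb hJ haa' hg hfreq hrun
    (show 0 < ε / (Real.log J.card + 1) by positivity)
  refine ⟨Real.log J.card * C, fun M e he hclose k hk => ?_⟩
  obtain ⟨B, hB, hlog⟩ := hC M e he hclose
  calc ∑ i ∈ Finset.Ico k M, Real.log (J2 J (e i).2).card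
      ≤ ∑ i ∈ Finset.Ico k M, (Real.log (J2 J a).card + if i ∈ B then Real.log J.card else 0) := by
        refine Finset.sum_le_sum fun i hi => ?_
        split_ifs with hiB
        · exact (log_card_J2_le _).trans (le_add_of_nonneg_left (log_card_nonneg _))
        · simpa using hlog i (Finset.mem_Ico.1 hi).2 hiB
    _ = ((M : ℝ) - k) * Real.log (J2 J a).card +
          ((Finset.Ico k M).filter (· ∈ B)).card * Real.log J.card := by
        rw [Finset.sum_add_distrib, ← Finset.sum_filter]
        simp [Nat.cast_sub hk]
    _ ≤ ((M : ℝ) - k) * Real.log (J2 J a).card + B.card * Real.log J.card := by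
        have : ((Finset.Ico k M).filter (· ∈ B)).card ≤ B.card :=
          Finset.card_le_card fun i hi => (Finset.mem_filter.1 hi).2
        gcongr
    _ ≤ ((M : ℝ) - k) * Real.log (J2 J a).card + ε * M + Real.log J.card * C := by
        have h1 := mul_le_mul_of_nonneg_right hB hK
        have h2 : ε / (Real.log J.card + 1) * M * Real.log J.card ≤ ε * M := by
          rw [div_mul_eq_mul_div, div_mul_eq_mul_div, div_le_iff₀ (by positivity)]
          have : 0 ≤ ε * M := by positivity
          linarith
        linarith

theorem le_sum_log_row {a : ℕ} {g : ℕ → ℕ × ℕ} {ε C : ℝ}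
    (hfreq : ∀ L : ℕ, (((Finset.range L).filter fun i => (g i).2 ≠ a).card : ℝ) ≤ ε * L + C)
    {k j : ℕ} (hk : k ≤ j) :
    ((j : ℝ) - k) * Real.log (J2 J a).card - Real.log (J2 J a).card * (ε * j + C) ≤
      ∑ i ∈ Finset.Ico k j, Real.log (J2 J (g i).2).card := by
  have hc := log_card_nonneg (J2 J a)
  calc _ ≤ ((j : ℝ) - k) * Real.log (J2 J a).card -
          ((Finset.Ico k j).filter fun i => (g i).2 ≠ a).card * Real.log (J2 J a).card := by
        have h1 : ((Finset.Ico k j).filter fun i => (g i).2 ≠ a).card ≤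
            ((Finset.range j).filter fun i => (g i).2 ≠ a).card :=
          Finset.card_le_card (Finset.filter_subset_filter _ fun i hi =>
            Finset.mem_range.2 (Finset.mem_Ico.1 hi).2)
        have h2 := mul_le_mul_of_nonneg_right ((Nat.cast_le (α := ℝ).2 h1).trans (hfreq j)) hc
        linarith
    _ = ∑ i ∈ Finset.Ico k j, (Real.log (J2 J a).card -
          if (g i).2 ≠ a then Real.log (J2 J a).card else 0) := by
        rw [Finset.sum_sub_distrib, ← Finset.sum_filter]
        simp [Nat.cast_sub hk]
    _ ≤ _ := by
        refine Finset.sum_le_sum fun i _ => ?_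
        split_ifs with h
        · simpa using log_card_nonneg _
        · rw [not_not] at h
          rw [h, sub_zero]

theorem exists_card_ne_le_of_freqCount {u : ℕ → ℕ} {a : ℕ}
    (h : Tendsto (fun n : ℕ => (freqCount u a n : ℝ) / n) atTop (𝓝 1)) {ε : ℝ} (hε : 0 < ε) :
    ∃ C : ℝ, ∀ L : ℕ, (((Finset.range L).filter fun i => u (i + 1) ≠ a).card : ℝ) ≤ ε * L + C := by
  have hcount : ∀ L : ℕ, (((Finset.range L).filter fun i => u (i + 1) ≠ a).card : ℝ) =
      L - freqCount u a L := fun L => by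
    have h1 : freqCount u a L = ((Finset.range L).filter fun i => u (i + 1) = a).card := by
      rw [freqCount]
      symm
      refine Finset.card_bij (fun i _ => i + 1) ?_ (fun i _ j _ hij => Nat.succ_injective hij) ?_
      · intro i hi
        simp only [Finset.mem_filter, Finset.mem_range, Finset.mem_Icc] at hi ⊢
        exact ⟨by omega, hi.2⟩
      · intro i hi
        simp only [Finset.mem_filter, Finset.mem_Icc] at hi
        refine ⟨i - 1, ?_, by omega⟩
        simp only [Finset.mem_filter, Finset.mem_range]
        rw [Nat.sub_add_cancel hi.1.1]
        exact ⟨by omega, hi.2⟩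
    have h2 := Finset.card_filter_add_card_filter_not (s := Finset.range L) fun i => u (i + 1) = a
    rw [Finset.card_range] at h2
    rw [h1, eq_sub_iff_add_eq, add_comm]
    exact_mod_cast h2
  have hlim : Tendsto (fun n : ℕ =>
      (((Finset.range n).filter fun i => u (i + 1) ≠ a).card : ℝ) / n) atTop (𝓝 0) := by
    have h1 : Tendsto (fun n : ℕ => 1 - (freqCount u a n : ℝ) / n) atTop (𝓝 (1 - 1)) :=
      tendsto_const_nhds.sub h
    rw [sub_self] at h1
    refine h1.congr' ?_
    filter_upwards [eventually_gt_atTop 0] with n hn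
    have : (n : ℝ) ≠ 0 := by exact_mod_cast hn.ne'
    rw [hcount]
    field_simp
  obtain ⟨C, -, hC⟩ := le_linear_of_tendsto_div_zero hlim hε
  exact ⟨C, hC⟩

theorem exists_run_length_le {u : ℕ → ℕ} {a : ℕ} (hinf : {i : ℕ | 1 ≤ i ∧ u i ≠ a}.Infinite)
    (h : Tendsto (fun n : ℕ => ((sInf {m : ℕ | 1 ≤ m ∧ u (n + m) ≠ a} : ℕ) : ℝ) / n) atTop (𝓝 0))
    {ε : ℝ} (hε : 0 < ε) :
    ∃ C : ℝ, 0 ≤ C ∧ ∀ j L : ℕ, (∀ i, j < i → i < L → u (i + 1) = a) → (L : ℝ) - j ≤ ε * L + C := by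
  obtain ⟨C, hC, hbound⟩ := le_linear_of_tendsto_div_zero h hε
  refine ⟨C, hC, fun j L hrun => ?_⟩
  have hL0 : 0 ≤ ε * L := by positivity
  rcases le_or_gt L j with hLj | hLj
  · have : (L : ℝ) ≤ j := by exact_mod_cast hLj
    linarith
  obtain ⟨i, hi, hji⟩ := hinf.exists_gt (j + 1)
  have hne : {m : ℕ | 1 ≤ m ∧ u (j + 1 + m) ≠ a}.Nonempty := by
    refine ⟨i - (j + 1), by omega, ?_⟩
    rw [Nat.add_sub_cancel' hji.le]
    exact hi.2
  obtain ⟨hm1, hm2⟩ := Nat.sInf_mem hne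
  have hlen : L ≤ j + sInf {m : ℕ | 1 ≤ m ∧ u (j + 1 + m) ≠ a} := by
    by_contra! hlt
    refine hm2 ?_
    rw [add_right_comm]
    exact hrun _ (by omega) hlt
  have h1 := hbound (j + 1)
  have h2 : (L : ℝ) ≤ j + (sInf {m : ℕ | 1 ≤ m ∧ u (j + 1 + m) ≠ a} : ℕ) := by exact_mod_cast hlen
  have h3 : ((j + 1 : ℕ) : ℝ) ≤ L := by exact_mod_cast hLj
  have h4 := mul_le_mul_of_nonneg_left h3 hε.le
  linarith

end RowEstimates

section Dimension

variable {b : ℕ} {J : Finset (ℕ × ℕ)}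

theorem add_mul_le_of_endpoints {A T c n k m j : ℝ} (hk : T * (n + k) ≤ A)
    (hm : T * (n + m) ≤ A + (m - k) * c) (hkj : k ≤ j) (hjm : j ≤ m) :
    T * (n + j) ≤ A + (j - k) * c := by
  rcases le_total T c with h | h
  · have := mul_le_mul_of_nonneg_right h (sub_nonneg.2 hkj)
    linarith
  · have := mul_le_mul_of_nonneg_right h (sub_nonneg.2 hjm)
    linarith

theorem tendsto_pred_div {u : ℕ → ℕ} (hu : ∀ n, 1 ≤ u n) {y : ℝ}
    (h : Tendsto (fun n : ℕ => (u n : ℝ) / n) atTop (𝓝 y)) :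
    Tendsto (fun n : ℕ => ((u n - 1 : ℕ) : ℝ) / n) atTop (𝓝 y) := by
  have h1 := h.sub (tendsto_one_div_atTop_nhds_zero_nat (𝕜 := ℝ))
  rw [sub_zero] at h1
  refine h1.congr fun n => ?_
  rw [Nat.cast_sub (hu n), Nat.cast_one, sub_div]

theorem nonneg_of_tendsto_div {u : ℕ → ℕ} {y : ℝ}
    (h : Tendsto (fun n : ℕ => (u n : ℝ) / n) atTop (𝓝 y)) : 0 ≤ y :=
  ge_of_tendsto' h fun _ => by positivity

theorem eventually_window_le {a : ℕ} {g : ℕ → ℕ × ℕ}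
    (hfreq : ∀ ε : ℝ, 0 < ε → ∃ C : ℝ, ∀ L : ℕ,
      (((Finset.range L).filter fun i => (g i).2 ≠ a).card : ℝ) ≤ ε * L + C)
    {lam xi : ℕ → ℕ} {l x T : ℝ}
    (hl : Tendsto (fun n : ℕ => (lam n : ℝ) / n) atTop (𝓝 l))
    (hx : Tendsto (fun n : ℕ => (xi n : ℝ) / n) atTop (𝓝 x)) (hT : 0 ≤ T)
    (hT₁ : T * (1 + l) < Real.log J.card)
    (hT₂ : T * (1 + x) < Real.log J.card + (x - l) * Real.log (J2 J a).card) :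
    ∃ ε : ℝ, 0 < ε ∧ ∀ᶠ n : ℕ in atTop, ∀ j ≤ xi n, T * ((n : ℝ) + j) ≤
      (1 - ε) * n * Real.log J.card + ∑ i ∈ Finset.Ico (lam n) j, Real.log (J2 J (g i).2).card := by
  have hx0 := nonneg_of_tendsto_div hx
  have hG := log_card_nonneg J
  have hc := log_card_nonneg (J2 J a)
  set G := Real.log J.card
  set c := Real.log (J2 J a).card
  obtain ⟨δ, hδ, hδ₁, hδ₂⟩ : ∃ δ : ℝ, 0 < δ ∧ T * (1 + l) + δ ≤ G ∧
      T * (1 + x) + δ ≤ G + (x - l) * c :=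
    ⟨min (G - T * (1 + l)) (G + (x - l) * c - T * (1 + x)),
      lt_min (sub_pos.2 hT₁) (sub_pos.2 hT₂),
      by linarith [min_le_left (G - T * (1 + l)) (G + (x - l) * c - T * (1 + x))],
      by linarith [min_le_right (G - T * (1 + l)) (G + (x - l) * c - T * (1 + x))]⟩
  have hden : 0 < G + c * x + 1 := by positivity
  obtain ⟨ε, hε, hεδ⟩ : ∃ ε : ℝ, 0 < ε ∧ ε * (G + c * x) < δ := by
    refine ⟨δ / (G + c * x + 1), by positivity, ?_⟩
    rw [div_mul_eq_mul_div, div_lt_iff₀ hden]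
    nlinarith
  obtain ⟨C, hC⟩ := hfreq ε hε
  refine ⟨ε, hε, ?_⟩
  have hinv : Tendsto (fun n : ℕ => (1 : ℝ) / n) atTop (𝓝 0) := tendsto_one_div_atTop_nhds_zero_nat
  have hA : Tendsto (fun n : ℕ => (1 - ε) * G - c * ε * ((xi n : ℝ) / n) - c * C * (1 / n)) atTop
      (𝓝 ((1 - ε) * G - c * ε * x - c * C * 0)) :=
    (tendsto_const_nhds.sub (hx.const_mul _)).sub (hinv.const_mul _)
  have h₁ : Tendsto (fun n : ℕ => T * (1 + (lam n : ℝ) / n)) atTop (𝓝 (T * (1 + l))) :=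
    (tendsto_const_nhds.add hl).const_mul T
  have h₂ : Tendsto (fun n : ℕ => T * (1 + (xi n : ℝ) / n)) atTop (𝓝 (T * (1 + x))) :=
    (tendsto_const_nhds.add hx).const_mul T
  filter_upwards [h₁.eventually_lt hA (by linarith),
    h₂.eventually_lt (hA.add ((hx.sub hl).mul_const c)) (by linarith), eventually_gt_atTop 0]
    with n hn₁ hn₂ hn0 j hj
  have hn : (0 : ℝ) < n := by exact_mod_cast hn0
  have hk : T * (n + lam n) ≤ (1 - ε) * n * G - c * (ε * xi n + C) := by
    have := mul_le_mul_of_nonneg_right hn₁.le hn.le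
    field_simp at this
    linarith
  have hm : T * (n + xi n) ≤ (1 - ε) * n * G - c * (ε * xi n + C) + ((xi n : ℝ) - lam n) * c := by
    have := mul_le_mul_of_nonneg_right hn₂.le hn.le
    field_simp at this
    linarith
  have hC0 : 0 ≤ C := by simpa using hC 0
  rcases le_total j (lam n) with hjl | hjl
  · rw [Finset.Ico_eq_empty (by omega), Finset.sum_empty]
    have h1 : T * ((n : ℝ) + j) ≤ T * (n + lam n) := by gcongr
    have h2 : 0 ≤ c * (ε * xi n + C) := by positivity
    linarith
  · have h1 := add_mul_le_of_endpoints hk hm (Nat.cast_le.2 hjl) (Nat.cast_le.2 hj)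
    have h2 := le_sum_log_row (J := J) hC hjl
    have h3 : c * (ε * j + C) ≤ c * (ε * xi n + C) := by gcongr
    linarith

theorem dimH_targetSet_eq (hb : 2 ≤ b) (hJ : ∀ e ∈ J, e.1 < b ∧ e.2 < b) (hJcard : 2 ≤ J.card)
    (R : RepMap b J) {lam xi : ℕ → ℕ} (hlam : ∀ n, 1 ≤ lam n) (hle : ∀ n, lam n ≤ xi n) {z w : ℝ}
    (hzw : (z, w) ∈ carpet b J) {l x : ℝ}
    (hl : Tendsto (fun n : ℕ => (lam n : ℝ) / n) atTop (𝓝 l))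
    (hx : Tendsto (fun n : ℕ => (xi n : ℝ) / n) atTop (𝓝 x)) (hlx : l < x) {a a' : ℕ}
    (haa' : a = 0 ∧ a' = b - 1 ∨ a = b - 1 ∧ a' = 0)
    (hinf : {i : ℕ | 1 ≤ i ∧ wdig R (z, w) i ≠ a}.Infinite)
    (hfreq : Tendsto (fun n : ℕ => (freqCount (wdig R (z, w)) a n : ℝ) / n) atTop (𝓝 1))
    (hrun : (J2 J a').card ≤ (J2 J a).card ∨
      Tendsto (fun n : ℕ => ((sInf {m : ℕ | 1 ≤ m ∧ wdig R (z, w) (n + m) ≠ a} : ℕ) : ℝ) / n)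
        atTop (𝓝 0)) :
    dimH (targetSet R lam xi z w) =
      ENNReal.ofReal (min ((Real.log J.card / Real.log b) / (1 + l))
        (((Real.log J.card / Real.log b) + (x - l) * (Real.log ((J2 J a).card) / Real.log b)) /
          (1 + x))) := by
  have hl0 := nonneg_of_tendsto_div hl
  have hx0 := nonneg_of_tendsto_div hx
  have hB : 0 < Real.log b := Real.log_pos (by exact_mod_cast hb)
  have hG : 0 < Real.log J.card := Real.log_pos (by exact_mod_cast hJcard)
  have hc := log_card_nonneg (J2 J a)
  have hgJ : ∀ i, R.rep (z, w) (i + 1) ∈ J := rep_succ_mem R hzw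
  have hfreq' : ∀ ε : ℝ, 0 < ε → ∃ C : ℝ, ∀ L : ℕ,
      (((Finset.range L).filter fun i => (R.rep (z, w) (i + 1)).2 ≠ a).card : ℝ) ≤ ε * L + C :=
    fun ε hε => exists_card_ne_le_of_freqCount hfreq hε
  have hrow := fun ε (hε : (0 : ℝ) < ε) => exists_sum_log_row_le hb hJ haa' hgJ hfreq'
    (hrun.imp_right fun h ε hε => exists_run_length_le hinf h hε) hε
  set s₁ := (Real.log J.card / Real.log b) / (1 + l) with hs₁
  set s₂ := ((Real.log J.card / Real.log b) +
    (x - l) * (Real.log ((J2 J a).card) / Real.log b)) / (1 + x) with hs₂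
  have hs₁_eq : s₁ * (1 + l) * Real.log b = Real.log J.card := by
    rw [hs₁]
    field_simp
  have hs₂_eq : s₂ * (1 + x) * Real.log b =
      Real.log J.card + (x - l) * Real.log (J2 J a).card := by
    rw [hs₂]
    field_simp
  have hs₁_pos : 0 < s₁ := by positivity
  have hs₂_pos : 0 < s₂ := by
    have := sub_pos.2 hlx
    positivity
  refine le_antisymm ?_ ?_
  · refine ge_of_tendsto ((ENNReal.continuous_ofReal.tendsto _).mono_left
      (nhdsWithin_le_nhds (s := Ioi (min s₁ s₂)))) (eventually_mem_nhdsWithin.mono fun s hs => ?_)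
    rw [Set.mem_Ioi] at hs
    have hs0 : 0 ≤ s := (lt_min hs₁_pos hs₂_pos).le.trans hs.le
    rcases min_lt_iff.1 hs with h | h
    · refine dimH_targetSet_le hb hJ R hlam (L := fun n => lam n - 1) (fun n => by omega)
        (fun n => ?_) hzw hl (tendsto_pred_div hlam hl) hrow hs0 ?_
      · rw [Nat.sub_add_cancel (hlam n)]
        exact hle n
      · rw [sub_self, zero_mul, add_zero, ← hs₁_eq]
        gcongr
    · refine dimH_targetSet_le hb hJ R hlam (L := fun n => xi n - 1)
        (fun n => ?_) (fun n => ?_) hzw hl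
        (tendsto_pred_div (fun n => (hlam n).trans (hle n)) hx) hrow hs0 ?_
      · rw [Nat.sub_add_cancel ((hlam n).trans (hle n))]
        exact hle n
      · rw [Nat.sub_add_cancel ((hlam n).trans (hle n))]
      · rw [← hs₂_eq]
        gcongr
  · refine le_of_tendsto ((ENNReal.continuous_ofReal.tendsto _).mono_left
      (nhdsWithin_le_nhds (s := Iio (min s₁ s₂)))) ?_
    filter_upwards [Ioo_mem_nhdsLT (lt_min hs₁_pos hs₂_pos)] with t ht
    obtain ⟨ht₁, ht₂⟩ := lt_min_iff.1 ht.2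
    have hT : 0 < t * Real.log b := mul_pos ht.1 hB
    have hT₁ : t * Real.log b * (1 + l) < Real.log J.card := by
      rw [← hs₁_eq, mul_right_comm]
      gcongr
    have hT₂ : t * Real.log b * (1 + x) <
        Real.log J.card + (x - l) * Real.log (J2 J a).card := by
      rw [← hs₂_eq, mul_right_comm]
      gcongr
    obtain ⟨ε, hε, hwin⟩ := eventually_window_le hfreq' hl hx hT.le hT₁ hT₂
    exact le_dimH_targetSet hb hJ R hle hzw ht.1 hε
      ((le_mul_of_one_le_right hT.le (by linarith)).trans hT₁.le) hwin

end Dimension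

theorem stmt_16
    (b : ℕ) (J : Finset (ℕ × ℕ)) (hb : 2 ≤ b)
    (hJ : J ⊂ Finset.range b ×ˢ Finset.range b) (hJcard : 2 ≤ J.card)
    (R : RepMap b J) (lam xi : ℕ → ℕ)
    (hlam_pos : ∀ n, 1 ≤ lam n) (hle : ∀ n, lam n ≤ xi n)
    (hlam_top : Tendsto lam atTop atTop)
    (z w : ℝ) (hzw : (z, w) ∈ carpet b J)
    (l x : ℝ)
    (hl : Tendsto (fun n : ℕ => (lam n : ℝ) / n) atTop (𝓝 l))
    (hx : Tendsto (fun n : ℕ => (xi n : ℝ) / n) atTop (𝓝 x))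
    (hlx : l < x) :
    (({i : ℕ | 1 ≤ i ∧ wdig R (z, w) i ≠ 0}.Infinite ∧
      Tendsto (fun n : ℕ => (freqCount (wdig R (z, w)) 0 n : ℝ) / n) atTop (𝓝 1) ∧
      ((J2 J (b - 1)).card ≤ (J2 J 0).card ∨
        Tendsto
          (fun n : ℕ => ((sInf {m : ℕ | 1 ≤ m ∧ wdig R (z, w) (n + m) ≠ 0} : ℕ) : ℝ) / n)
          atTop (𝓝 0))) →
      dimH (targetSet R lam xi z w) =
        ENNReal.ofReal (min ((Real.log J.card / Real.log b) / (1 + l))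
          (((Real.log J.card / Real.log b) + (x - l) * (Real.log ((J2 J 0).card) / Real.log b)) / (1 + x)))) ∧
    (({i : ℕ | 1 ≤ i ∧ wdig R (z, w) i ≠ b - 1}.Infinite ∧
      Tendsto (fun n : ℕ => (freqCount (wdig R (z, w)) (b - 1) n : ℝ) / n) atTop (𝓝 1) ∧
      ((J2 J 0).card ≤ (J2 J (b - 1)).card ∨
        Tendsto
          (fun n : ℕ => ((sInf {m : ℕ | 1 ≤ m ∧ wdig R (z, w) (n + m) ≠ b - 1} : ℕ) : ℝ) / n)
          atTop (𝓝 0))) →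
      dimH (targetSet R lam xi z w) =
        ENNReal.ofReal (min ((Real.log J.card / Real.log b) / (1 + l))
          (((Real.log J.card / Real.log b) + (x - l) * (Real.log ((J2 J (b - 1)).card) / Real.log b)) / (1 + x)))) := by
  have hJ' : ∀ e ∈ J, e.1 < b ∧ e.2 < b := fun e he => by
    simpa only [Finset.mem_product, Finset.mem_range] using hJ.1 he
  exact ⟨fun h => dimH_targetSet_eq hb hJ' hJcard R hlam_pos hle hzw hl hx hlx
      (Or.inl ⟨rfl, rfl⟩) h.1 h.2.1 h.2.2,
    fun h => dimH_targetSet_eq hb hJ' hJcard R hlam_pos hle hzw hl hx hlx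
      (Or.inr ⟨rfl, rfl⟩) h.1 h.2.1 h.2.2⟩

end ShrinkingRect
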